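/- Let L and H be finite-dimensional p-nilpotent restricted Lie algebras over a perfect field F of characteristic p > 0 and let φ : u(L) → u(H) be an algebra isomorphism with φ(ω(L)) = ω(H). Then the induced isomorphism ω(L)/J_L → ω(H)/J_H, restricted to (L + J_L)/J_L and followed by the projection onto (H + J_H)/J_H along φ(E)/J_H, is an isomorphism of restricted Lie algebras (L + J_L)/J_L ≅ (H + J_H)/J_H; consequently L/(L'^p + γ₃(L)) ≅ H/(H'^p + γ₃(H)). -/

import Mathlib

open UniversalEnvelopingAlgebra

attribute [local instance 100] LieRing.ofAssociativeRing

/-- A restricted Lie algebra over a field `F` of characteristic `p`: a Lie algebra equipped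
with a `p`-map `x ↦ x^[p]` satisfying Jacobson's identities.  The additive identity
`(x+y)^[p] = x^[p] + y^[p] + Σ sᵢ(x,y)` (with `sᵢ` the Jacobson polynomials) is expressed
faithfully inside the universal enveloping algebra, where it reads
`ι((x+y)^[p]) - ι(x^[p]) - ι(y^[p]) = (ι x + ι y)^p - (ι x)^p - (ι y)^p`. -/
class RestrictedLieAlgebra (p : ℕ) (F : Type*) (L : Type*) [Field F]
    [LieRing L] [LieAlgebra F L] : Type _ where
  pOp : L → L
  pOp_smul : ∀ (a : F) (x : L), pOp (a • x) = a ^ p • pOp x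
  ad_pOp : ∀ x y : L, ⁅pOp x, y⁆ = ((LieAlgebra.ad F L x) ^ p) y
  pOp_add : ∀ x y : L,
    ι F (pOp (x + y)) - ι F (pOp x) - ι F (pOp y)
      = (ι F x + ι F y) ^ p - (ι F x) ^ p - (ι F y) ^ p

namespace RestrictedLieAlgebra

variable (p : ℕ) (F : Type*) [Field F]

section Defs

variable (L : Type*) [LieRing L] [LieAlgebra F L] [RestrictedLieAlgebra p F L]

/-- The `p`-map of a restricted Lie algebra. -/
abbrev pmap (x : L) : L := RestrictedLieAlgebra.pOp (p := p) (F := F) x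

/-- The relation defining the restricted enveloping algebra as a quotient of the
universal enveloping algebra: `x^p = x^[p]` for all `x ∈ L`. -/
def uRel : UniversalEnvelopingAlgebra F L → UniversalEnvelopingAlgebra F L → Prop :=
  fun a b => ∃ x : L, a = (ι F x) ^ p ∧ b = ι F (pmap p F L x)

/-- The restricted enveloping algebra `u(L)`: the quotient of the universal enveloping
algebra of `L` by the two-sided ideal generated by `{x^p - x^[p] : x ∈ L}`. -/
abbrev uEnv := RingQuot (uRel p F L)

/-- The canonical (linear) embedding `L → u(L)`. -/
def uemb : L →ₗ[F] uEnv p F L :=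
  ((RingQuot.mkAlgHom F (uRel p F L)).toLinearMap).comp (ι F : L →ₗ⁅F⁆ _).toLinearMap

variable [Fact p.Prime]

/-- The augmentation map `ε : u(L) → F`, induced by `x ↦ 0` for `x ∈ L`. -/
noncomputable def aug : uEnv p F L →ₐ[F] F :=
  RingQuot.liftAlgHom F
    ⟨(UniversalEnvelopingAlgebra.lift F) (0 : L →ₗ⁅F⁆ F), by
      rintro a b ⟨x, rfl, rfl⟩
      simp [UniversalEnvelopingAlgebra.lift_ι_apply,
        zero_pow (Nat.Prime.ne_zero (Fact.out : p.Prime))]⟩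

/-- The augmentation ideal `ω(L)`, i.e. the kernel of the augmentation map, as a
subspace of `u(L)`. -/
noncomputable def omegaIdeal : Submodule F (uEnv p F L) :=
  LinearMap.ker (aug p F L).toLinearMap

/-- The image of `L` inside `u(L)`. -/
def lSub : Submodule F (uEnv p F L) := LinearMap.range (uemb p F L)

end Defs

section Closure

variable {L : Type*} [LieRing L] [LieAlgebra F L] [RestrictedLieAlgebra p F L]

/-- The restricted subalgebra generated by a subset `S` of `L`: the smallest Lie
subalgebra containing `S` which is closed under the `p`-map. -/
def restrictedClosure (S : Set L) : LieSubalgebra F L :=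
  sInf {K : LieSubalgebra F L | S ⊆ K ∧ ∀ x ∈ K, pmap p F L x ∈ K}

/-- For a subalgebra `N ⊆ L`, the restricted subalgebra `N^p` generated by all
`x^[p]`, `x ∈ N`. -/
def subPPow (K : LieSubalgebra F L) : LieSubalgebra F L :=
  restrictedClosure p F (pmap p F L '' K)

end Closure

section PNilpotent

variable (L : Type*) [LieRing L] [LieAlgebra F L] [RestrictedLieAlgebra p F L]

/-- `L` is `p`-nilpotent if `L^{pˢ} = 0` for some `s`, where `L^p` denotes the restricted
subalgebra generated by all `x^[p]`. -/
def IsPNilpotent : Prop :=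
  ∃ s : ℕ, (subPPow p F)^[s] (⊤ : LieSubalgebra F L) = ⊥

/-- The derived subalgebra `L' = γ₂(L)` as a submodule of `L`. -/
abbrev derivedSub : Submodule F L := (LieModule.lowerCentralSeries F L L 1).toSubmodule

/-- `L'_p`, the restricted subalgebra generated by `L'`, as a submodule. -/
def derivedP : Submodule F L :=
  (restrictedClosure p F (derivedSub F L : Set L)).toSubmodule

/-- `L'^p + γ₃(L)`, as a submodule of `L`. -/
def mainIdeal : Submodule F L :=
  (subPPow p F (restrictedClosure p F (derivedSub F L : Set L))).toSubmodule
    ⊔ (LieModule.lowerCentralSeries F L L 2).toSubmodule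

end PNilpotent

end RestrictedLieAlgebra

namespace RestrictedLieAlgebra

section Setup

variable (p : ℕ) (F : Type*) [Field F] [Fact p.Prime]
variable (L : Type*) [LieRing L] [LieAlgebra F L] [RestrictedLieAlgebra p F L]

/-- The ideal `J_L = ω(L)L' + L'ω(L)` of `u(L)`, as a subspace. -/
noncomputable def jIdeal : Submodule F (uEnv p F L) :=
  omegaIdeal p F L * ((derivedSub F L).map (uemb p F L))
    + ((derivedSub F L).map (uemb p F L)) * omegaIdeal p F L

/-- The subspace `E` of `u(L)`: the span of `J_L` together with all PBW monomials of
degree at least two in the fixed set `X` of representatives. -/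
noncomputable def eSpace (n : ℕ) (ex : Fin n → ℕ) (X : (i : Fin n) → Fin (ex i) → L) :
    Submodule F (uEnv p F L) :=
  jIdeal p F L ⊔
    Submodule.span F
      {u : uEnv p F L | ∃ a : (i : Fin n) → Fin (ex i) → ℕ,
        (∀ i j, a i j < p) ∧ 2 ≤ ∑ i, ∑ j, a i j ∧
        u = ((List.finRange n).map (fun i =>
              ((List.finRange (ex i)).map
                (fun j => uemb p F L (X i j) ^ a i j)).prod)).prod}

/-- The data `e₁, …, e_n ∈ L` together with exponents `ex i = exp(ēᵢ)` and a set `X` of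
coset representatives, expressing the decomposition
`L/L'_p = ⟨ē₁⟩_p ⊕ ⋯ ⊕ ⟨ē_n⟩_p` via the resulting basis `ēᵢ^{[p]^j}` (`0 ≤ j < ex i`)
of `L/L'_p`. -/
def GoodPresentation (n : ℕ) (e : Fin n → L) (ex : Fin n → ℕ)
    (X : (i : Fin n) → Fin (ex i) → L) : Prop :=
  LinearIndependent F
    (fun q : Σ i : Fin n, Fin (ex i) =>
      (Submodule.Quotient.mk ((pmap p F L)^[(q.2 : ℕ)] (e q.1)) : L ⧸ derivedP p F L)) ∧
  Submodule.span F
    (Set.range (fun q : Σ i : Fin n, Fin (ex i) =>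
      (Submodule.Quotient.mk ((pmap p F L)^[(q.2 : ℕ)] (e q.1)) : L ⧸ derivedP p F L))) = ⊤ ∧
  (∀ i, (pmap p F L)^[ex i] (e i) ∈ derivedP p F L) ∧
  (∀ i (j : Fin (ex i)), X i j - (pmap p F L)^[(j : ℕ)] (e i) ∈ derivedP p F L)

end Setup

end RestrictedLieAlgebra

namespace RestrictedLieAlgebra

section EnvelopingAlgebra

variable (p : ℕ) (F : Type*) [Field F]
variable (L : Type*) [LieRing L] [LieAlgebra F L] [RestrictedLieAlgebra p F L]

theorem uemb_lie (x y : L) :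
    uemb p F L ⁅x, y⁆ = uemb p F L x * uemb p F L y - uemb p F L y * uemb p F L x := by
  simp only [uemb, LinearMap.comp_apply, LieHom.coe_toLinearMap, LieHom.map_lie,
    AlgHom.toLinearMap_apply, LieRing.of_associative_ring_bracket, map_sub, map_mul]

theorem uemb_pmap (x : L) : uemb p F L (pmap p F L x) = uemb p F L x ^ p := by
  have h : RingQuot.mkAlgHom F (uRel p F L) (ι F x ^ p)
      = RingQuot.mkAlgHom F (uRel p F L) (ι F (pmap p F L x)) :=
    RingQuot.mkAlgHom_rel F ⟨x, rfl, rfl⟩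
  rw [map_pow] at h
  exact h.symm

theorem pmap_zero [Fact p.Prime] : pmap p F L 0 = 0 := by
  have h := RestrictedLieAlgebra.pOp_smul (p := p) (F := F) (0 : F) (0 : L)
  rwa [zero_smul, zero_pow (Fact.out : p.Prime).ne_zero, zero_smul] at h

/-- A linear map whose commutators realise the bracket satisfies Jacobson's formula. -/
theorem map_pmap_add {A : Type*} [Ring A] [Algebra F A] (f : L →ₗ[F] A)
    (hf : ∀ x y, f ⁅x, y⁆ = f x * f y - f y * f x) (x y : L) :
    f (pmap p F L (x + y)) - f (pmap p F L x) - f (pmap p F L y)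
      = (f x + f y) ^ p - f x ^ p - f y ^ p := by
  let g : L →ₗ⁅F⁆ A := { f with
    map_lie' := by
      intro x y
      simpa [LieRing.of_associative_ring_bracket] using hf x y }
  have h := congrArg (UniversalEnvelopingAlgebra.lift F g)
    (RestrictedLieAlgebra.pOp_add (p := p) (F := F) x y)
  simp only [map_sub, map_pow, map_add, UniversalEnvelopingAlgebra.lift_ι_apply] at h
  exact h

/-- The universal property of the restricted enveloping algebra. -/
theorem exists_uEnv_lift {A : Type*} [Ring A] [Algebra F A] (f : L →ₗ[F] A)
    (hf : ∀ x y, f ⁅x, y⁆ = f x * f y - f y * f x)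
    (hp : ∀ x, f (pmap p F L x) = f x ^ p) :
    ∃ g : uEnv p F L →ₐ[F] A, ∀ x, g (uemb p F L x) = f x := by
  let g : L →ₗ⁅F⁆ A := { f with
    map_lie' := by
      intro x y
      simpa [LieRing.of_associative_ring_bracket] using hf x y }
  refine ⟨RingQuot.liftAlgHom F ⟨UniversalEnvelopingAlgebra.lift F g, ?_⟩, fun x => ?_⟩
  · rintro _ _ ⟨x, rfl, rfl⟩
    rw [map_pow, UniversalEnvelopingAlgebra.lift_ι_apply, UniversalEnvelopingAlgebra.lift_ι_apply]
    exact (hp x).symm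
  · simp only [uemb, LinearMap.comp_apply, LieHom.coe_toLinearMap, AlgHom.toLinearMap_apply]
    rw [RingQuot.liftAlgHom_mkAlgHom_apply, UniversalEnvelopingAlgebra.lift_ι_apply]
    rfl

theorem adjoin_range_uemb : Algebra.adjoin F (Set.range (uemb p F L)) = ⊤ := by
  set S := Algebra.adjoin F (Set.range (uemb p F L)) with hS
  have hmem : ∀ x, uemb p F L x ∈ S := fun x => Algebra.subset_adjoin ⟨x, rfl⟩
  obtain ⟨g, hg⟩ := exists_uEnv_lift p F L
    (A := S) (LinearMap.codRestrict (Subalgebra.toSubmodule S) (uemb p F L) hmem)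
    (fun x y => Subtype.ext (uemb_lie p F L x y)) (fun x => Subtype.ext (uemb_pmap p F L x))
  have hid : S.val.comp g = AlgHom.id F _ := by
    apply RingQuot.ringQuot_ext'
    apply UniversalEnvelopingAlgebra.hom_ext
    ext x
    exact congrArg Subtype.val (hg x)
  rw [eq_top_iff]
  intro a _
  have h : (g a : uEnv p F L) = a := DFunLike.congr_fun hid a
  exact h ▸ (g a).2

variable {L} in
theorem uEnv_induction {P : uEnv p F L → Prop} (hx : ∀ x, P (uemb p F L x))
    (hc : ∀ c, P (algebraMap F _ c)) (hadd : ∀ a b, P a → P b → P (a + b))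
    (hmul : ∀ a b, P a → P b → P (a * b)) (a : uEnv p F L) : P a := by
  have ha : a ∈ Algebra.adjoin F (Set.range (uemb p F L)) := by
    rw [adjoin_range_uemb]; trivial
  induction ha using Algebra.adjoin_induction with
  | mem x hx' => obtain ⟨y, rfl⟩ := hx'; exact hx y
  | algebraMap c => exact hc c
  | add a b _ _ h1 h2 => exact hadd _ _ h1 h2
  | mul a b _ _ h1 h2 => exact hmul _ _ h1 h2

end EnvelopingAlgebra

section LowerCentralSeries

variable (F : Type*) [Field F] {L : Type*} [LieRing L] [LieAlgebra F L]

theorem lie_mem_derivedSub (x y : L) : ⁅x, y⁆ ∈ derivedSub F L := by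
  change ⁅x, y⁆ ∈ LieModule.lowerCentralSeries F L L 1
  rw [LieModule.lowerCentralSeries_succ]
  exact LieSubmodule.lie_mem_lie (LieSubmodule.mem_top x) (LieSubmodule.mem_top y)

theorem lie_mem_lowerCentralSeries_two (x : L) {y : L} (hy : y ∈ derivedSub F L) :
    ⁅x, y⁆ ∈ LieModule.lowerCentralSeries F L L 2 := by
  rw [LieModule.lowerCentralSeries_succ]
  exact LieSubmodule.lie_mem_lie (LieSubmodule.mem_top x) hy

theorem derivedSub_le {N : Submodule F L} (h : ∀ x y : L, ⁅x, y⁆ ∈ N) : derivedSub F L ≤ N := by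
  change (LieModule.lowerCentralSeries F L L 1).toSubmodule ≤ N
  rw [LieModule.lowerCentralSeries_succ, LieSubmodule.lieIdeal_oper_eq_linear_span',
    Submodule.span_le]
  rintro _ ⟨x, _, y, _, rfl⟩
  exact h x y

theorem lowerCentralSeries_two_le {N : Submodule F L}
    (h : ∀ (x : L), ∀ y ∈ derivedSub F L, ⁅x, y⁆ ∈ N) :
    (LieModule.lowerCentralSeries F L L 2).toSubmodule ≤ N := by
  rw [LieModule.lowerCentralSeries_succ, LieSubmodule.lieIdeal_oper_eq_linear_span',
    Submodule.span_le]
  rintro _ ⟨x, _, y, hy, rfl⟩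
  exact h x y hy

end LowerCentralSeries

section Ideals

variable (p : ℕ) (F : Type*) [Field F]
variable {L : Type*} [LieRing L] [LieAlgebra F L] [RestrictedLieAlgebra p F L]

theorem restrictedClosure_le {S : Set L} {K : LieSubalgebra F L} (hS : S ⊆ K)
    (hK : ∀ x ∈ K, pmap p F L x ∈ K) : restrictedClosure p F S ≤ K :=
  sInf_le ⟨hS, hK⟩

theorem mem_restrictedClosure {S : Set L} {x : L} : x ∈ restrictedClosure p F S ↔
    ∀ K : LieSubalgebra F L, S ⊆ K → (∀ y ∈ K, pmap p F L y ∈ K) → x ∈ K := by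
  rw [restrictedClosure, ← SetLike.mem_coe, LieSubalgebra.coe_sInf]
  simp

theorem subset_restrictedClosure (S : Set L) : S ⊆ restrictedClosure p F S := fun _ hx =>
  (mem_restrictedClosure p F).2 fun _ hS _ => hS hx

theorem pmap_mem_restrictedClosure {S : Set L} {x : L} (hx : x ∈ restrictedClosure p F S) :
    pmap p F L x ∈ restrictedClosure p F S :=
  (mem_restrictedClosure p F).2 fun K hS hK => hK x ((mem_restrictedClosure p F).1 hx K hS hK)

theorem derivedSub_le_derivedP : derivedSub F L ≤ derivedP p F L :=
  subset_restrictedClosure p F _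

theorem pmap_mem_derivedP {x : L} (hx : x ∈ derivedP p F L) : pmap p F L x ∈ derivedP p F L :=
  pmap_mem_restrictedClosure p F hx

/-- A subspace containing `L'` and closed under the `p`-map contains `L'_p`. -/
theorem derivedP_le {N : Submodule F L} (h : ∀ x y : L, ⁅x, y⁆ ∈ N)
    (hp : ∀ x ∈ N, pmap p F L x ∈ N) : derivedP p F L ≤ N := by
  let K : LieSubalgebra F L := { N with lie_mem' := fun {x y} _ _ => h x y }
  exact restrictedClosure_le p F (K := K) (derivedSub_le F h) hp

theorem pmap_mem_mainIdeal {x : L} (hx : x ∈ derivedP p F L) :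
    pmap p F L x ∈ mainIdeal p F L :=
  Submodule.mem_sup_left (subset_restrictedClosure p F _ ⟨x, hx, rfl⟩)

theorem lie_mem_mainIdeal (x : L) {y : L} (hy : y ∈ derivedSub F L) : ⁅x, y⁆ ∈ mainIdeal p F L :=
  Submodule.mem_sup_right (lie_mem_lowerCentralSeries_two F x hy)

variable [Fact p.Prime]

theorem mem_omegaIdeal {a : uEnv p F L} : a ∈ omegaIdeal p F L ↔ aug p F L a = 0 := Iff.rfl

theorem aug_uemb (x : L) : aug p F L (uemb p F L x) = 0 := by
  simp only [aug, uemb, LinearMap.comp_apply, LieHom.coe_toLinearMap, AlgHom.toLinearMap_apply]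
  rw [RingQuot.liftAlgHom_mkAlgHom_apply, UniversalEnvelopingAlgebra.lift_ι_apply]
  rfl

theorem uemb_mem_omegaIdeal (x : L) : uemb p F L x ∈ omegaIdeal p F L := aug_uemb p F x

theorem mul_mem_omegaIdeal_left (a : uEnv p F L) {b : uEnv p F L} (hb : b ∈ omegaIdeal p F L) :
    a * b ∈ omegaIdeal p F L := by
  rw [mem_omegaIdeal] at hb ⊢
  rw [map_mul, hb, mul_zero]

theorem mul_mem_omegaIdeal_right {a : uEnv p F L} (b : uEnv p F L) (ha : a ∈ omegaIdeal p F L) :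
    a * b ∈ omegaIdeal p F L := by
  rw [mem_omegaIdeal] at ha ⊢
  rw [map_mul, ha, zero_mul]

theorem exists_eq_algebraMap_add (a : uEnv p F L) :
    ∃ c : F, ∃ w ∈ omegaIdeal p F L, a = algebraMap F _ c + w :=
  ⟨aug p F L a, a - algebraMap F _ (aug p F L a), by
    rw [mem_omegaIdeal, map_sub, AlgHom.commutes]; simp, by abel⟩

theorem omega_mul_derived_mem {w : uEnv p F L} (hw : w ∈ omegaIdeal p F L) {l : L}
    (hl : l ∈ derivedSub F L) : w * uemb p F L l ∈ jIdeal p F L :=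
  Submodule.mem_sup_left (Submodule.mul_mem_mul hw (Submodule.mem_map_of_mem hl))

theorem derived_mul_omega_mem {w : uEnv p F L} (hw : w ∈ omegaIdeal p F L) {l : L}
    (hl : l ∈ derivedSub F L) : uemb p F L l * w ∈ jIdeal p F L :=
  Submodule.mem_sup_right (Submodule.mul_mem_mul (Submodule.mem_map_of_mem hl) hw)

theorem jIdeal_le {N : Submodule F (uEnv p F L)}
    (h₁ : ∀ w ∈ omegaIdeal p F L, ∀ l ∈ derivedSub F L, w * uemb p F L l ∈ N)
    (h₂ : ∀ w ∈ omegaIdeal p F L, ∀ l ∈ derivedSub F L, uemb p F L l * w ∈ N) :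
    jIdeal p F L ≤ N := by
  refine sup_le (Submodule.mul_le.2 ?_) (Submodule.mul_le.2 ?_)
  · rintro w hw _ ⟨l, hl, rfl⟩
    exact h₁ w hw l hl
  · rintro _ ⟨l, hl, rfl⟩ w hw
    exact h₂ w hw l hl

theorem jIdeal_mul_mem_left (a : uEnv p F L) :
    ∀ b ∈ jIdeal p F L, a * b ∈ jIdeal p F L := by
  induction a using uEnv_induction with
  | hx x =>
    refine fun b hb => (jIdeal_le p F (N := (jIdeal p F L).comap
      (LinearMap.mulLeft F (uemb p F L x))) ?_ ?_) hb
    · intro w hw l hl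
      simpa [mul_assoc] using omega_mul_derived_mem p F
        (mul_mem_omegaIdeal_left p F (uemb p F L x) hw) hl
    · intro w hw l hl
      have h : uemb p F L x * (uemb p F L l * w)
          = uemb p F L l * (uemb p F L x * w) + uemb p F L ⁅x, l⁆ * w := by
        rw [uemb_lie]; noncomm_ring
      simp only [Submodule.mem_comap, LinearMap.mulLeft_apply, h]
      exact add_mem (derived_mul_omega_mem p F (mul_mem_omegaIdeal_left p F _ hw) hl)
        (derived_mul_omega_mem p F hw (lie_mem_derivedSub F x l))
  | hc c => intro b hb; rw [← Algebra.smul_def]; exact Submodule.smul_mem _ _ hb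
  | hadd a b ha hb => intro c hc; rw [add_mul]; exact add_mem (ha c hc) (hb c hc)
  | hmul a b ha hb => intro c hc; rw [mul_assoc]; exact ha _ (hb c hc)

theorem jIdeal_mul_mem_right (a : uEnv p F L) :
    ∀ b ∈ jIdeal p F L, b * a ∈ jIdeal p F L := by
  induction a using uEnv_induction with
  | hx x =>
    refine fun b hb => (jIdeal_le p F (N := (jIdeal p F L).comap
      (LinearMap.mulRight F (uemb p F L x))) ?_ ?_) hb
    · intro w hw l hl
      have h : w * uemb p F L l * uemb p F L x
          = w * uemb p F L x * uemb p F L l + w * uemb p F L ⁅l, x⁆ := by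
        rw [uemb_lie]; noncomm_ring
      simp only [Submodule.mem_comap, LinearMap.mulRight_apply, h]
      exact add_mem (omega_mul_derived_mem p F (mul_mem_omegaIdeal_right p F _ hw) hl)
        (omega_mul_derived_mem p F hw (lie_mem_derivedSub F l x))
    · intro w hw l hl
      simpa [mul_assoc] using derived_mul_omega_mem p F
        (mul_mem_omegaIdeal_right p F (uemb p F L x) hw) hl
  | hc c =>
    intro b hb
    rw [← Algebra.commutes, ← Algebra.smul_def]; exact Submodule.smul_mem _ _ hb
  | hadd a b ha hb => intro c hc; rw [mul_add]; exact add_mem (ha c hc) (hb c hc)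
  | hmul a b ha hb => intro c hc; rw [← mul_assoc]; exact hb _ (ha c hc)

variable (L) in
/-- The subspace `L' + J_L`, which is the two-sided ideal of `u(L)` generated by commutators. -/
noncomputable def commIdeal : Submodule F (uEnv p F L) :=
  (derivedSub F L).map (uemb p F L) ⊔ jIdeal p F L

theorem jIdeal_le_commIdeal : jIdeal p F L ≤ commIdeal p F L := le_sup_right

theorem derived_mem_commIdeal {l : L} (hl : l ∈ derivedSub F L) :
    uemb p F L l ∈ commIdeal p F L :=
  Submodule.mem_sup_left (Submodule.mem_map_of_mem hl)

theorem commIdeal_mul_omega_mem {k w : uEnv p F L} (hk : k ∈ commIdeal p F L)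
    (hw : w ∈ omegaIdeal p F L) : k * w ∈ jIdeal p F L := by
  obtain ⟨_, ⟨l, hl, rfl⟩, j, hj, rfl⟩ := Submodule.mem_sup.1 hk
  rw [add_mul]
  exact add_mem (derived_mul_omega_mem p F hw hl) (jIdeal_mul_mem_right p F w j hj)

theorem omega_mul_commIdeal_mem {k w : uEnv p F L} (hk : k ∈ commIdeal p F L)
    (hw : w ∈ omegaIdeal p F L) : w * k ∈ jIdeal p F L := by
  obtain ⟨_, ⟨l, hl, rfl⟩, j, hj, rfl⟩ := Submodule.mem_sup.1 hk
  rw [mul_add]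
  exact add_mem (omega_mul_derived_mem p F hw hl) (jIdeal_mul_mem_left p F w j hj)

theorem commIdeal_mul_mem_left (a : uEnv p F L) {k : uEnv p F L} (hk : k ∈ commIdeal p F L) :
    a * k ∈ commIdeal p F L := by
  obtain ⟨c, w, hw, rfl⟩ := exists_eq_algebraMap_add p F a
  rw [add_mul, ← Algebra.smul_def]
  exact add_mem (Submodule.smul_mem _ _ hk)
    (jIdeal_le_commIdeal p F (omega_mul_commIdeal_mem p F hk hw))

theorem commIdeal_mul_mem_right (a : uEnv p F L) {k : uEnv p F L} (hk : k ∈ commIdeal p F L) :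
    k * a ∈ commIdeal p F L := by
  obtain ⟨c, w, hw, rfl⟩ := exists_eq_algebraMap_add p F a
  rw [mul_add, ← Algebra.commutes, ← Algebra.smul_def]
  exact add_mem (Submodule.smul_mem _ _ hk)
    (jIdeal_le_commIdeal p F (commIdeal_mul_omega_mem p F hk hw))

theorem commutator_mem_commIdeal (a b : uEnv p F L) : a * b - b * a ∈ commIdeal p F L := by
  have key : ∀ (c : uEnv p F L), (∀ x : L, c * uemb p F L x - uemb p F L x * c ∈ commIdeal p F L) →
      ∀ a, c * a - a * c ∈ commIdeal p F L := by
    intro c hc a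
    induction a using uEnv_induction with
    | hx x => exact hc x
    | hc r => rw [Algebra.commutes, sub_self]; exact zero_mem _
    | hadd a b ha hb =>
      rw [show c * (a + b) - (a + b) * c = (c * a - a * c) + (c * b - b * c) by noncomm_ring]
      exact add_mem ha hb
    | hmul a b ha hb =>
      rw [show c * (a * b) - a * b * c = (c * a - a * c) * b + a * (c * b - b * c) by
        noncomm_ring]
      exact add_mem (commIdeal_mul_mem_right p F _ ha) (commIdeal_mul_mem_left p F _ hb)
  refine key a (fun x => ?_) b
  rw [← neg_sub]
  refine neg_mem (key _ (fun y => ?_) a)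
  rw [← uemb_lie]
  exact derived_mem_commIdeal p F (lie_mem_derivedSub F x y)

theorem commIdeal_le_omegaIdeal : commIdeal p F L ≤ omegaIdeal p F L := by
  refine sup_le ?_ (jIdeal_le p F (fun w _ l _ => ?_) fun w hw l _ => ?_)
  · rintro _ ⟨l, _, rfl⟩
    exact uemb_mem_omegaIdeal p F l
  · exact mul_mem_omegaIdeal_left p F _ (uemb_mem_omegaIdeal p F l)
  · exact mul_mem_omegaIdeal_left p F _ hw

theorem jIdeal_le_omegaIdeal : jIdeal p F L ≤ omegaIdeal p F L :=
  (jIdeal_le_commIdeal p F).trans (commIdeal_le_omegaIdeal p F)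

/-- Elements of `ω(L)²` commute with `ω(L)` modulo `J_L`. -/
theorem commutator_mul_mem_jIdeal {a b c : uEnv p F L} (ha : a ∈ omegaIdeal p F L)
    (hb : b ∈ omegaIdeal p F L) : (a * b) * c - c * (a * b) ∈ jIdeal p F L := by
  rw [show (a * b) * c - c * (a * b) = a * (b * c - c * b) + (a * c - c * a) * b by noncomm_ring]
  exact add_mem (omega_mul_commIdeal_mem p F (commutator_mem_commIdeal p F b c) ha)
    (commIdeal_mul_omega_mem p F (commutator_mem_commIdeal p F a c) hb)

theorem pow_mem_jIdeal_of_mem_commIdeal {a : uEnv p F L} (ha : a ∈ commIdeal p F L) :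
    a ^ p ∈ jIdeal p F L := by
  obtain ⟨k, hk⟩ := Nat.exists_eq_add_of_le (Fact.out : p.Prime).two_le
  have h : a ^ p = a * a * a ^ k := by rw [← pow_two, ← pow_add, ← hk]
  rw [h]
  exact jIdeal_mul_mem_right p F _ _
    (commIdeal_mul_omega_mem p F ha (commIdeal_le_omegaIdeal p F ha))

theorem pow_mem_jIdeal_of_mem_jIdeal {a : uEnv p F L} (ha : a ∈ jIdeal p F L) :
    a ^ p ∈ jIdeal p F L :=
  pow_mem_jIdeal_of_mem_commIdeal p F (jIdeal_le_commIdeal p F ha)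

theorem uemb_mem_commIdeal {x : L} (hx : x ∈ derivedP p F L) :
    uemb p F L x ∈ commIdeal p F L := by
  refine derivedP_le p F (N := (commIdeal p F L).comap (uemb p F L))
    (fun x y => derived_mem_commIdeal p F (lie_mem_derivedSub F x y)) (fun x hx => ?_) hx
  rw [Submodule.mem_comap, uemb_pmap]
  exact jIdeal_le_commIdeal p F (pow_mem_jIdeal_of_mem_commIdeal p F hx)

theorem uemb_mem_jIdeal_of_mem_mainIdeal {x : L} (hx : x ∈ mainIdeal p F L) :
    uemb p F L x ∈ jIdeal p F L := by
  have hle : mainIdeal p F L ≤ (jIdeal p F L).comap (uemb p F L) := by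
    refine sup_le ?_ (lowerCentralSeries_two_le F fun x y hy => ?_)
    · let K : LieSubalgebra F L := { (jIdeal p F L).comap (uemb p F L) with
        lie_mem' := fun {x y} hx hy => by
          change uemb p F L ⁅x, y⁆ ∈ jIdeal p F L
          rw [uemb_lie]
          exact sub_mem (jIdeal_mul_mem_left p F _ _ hy) (jIdeal_mul_mem_left p F _ _ hx) }
      refine restrictedClosure_le p F (K := K) ?_ fun x hx => ?_
      · rintro _ ⟨y, hy, rfl⟩
        change uemb p F L _ ∈ jIdeal p F L
        rw [uemb_pmap]
        exact pow_mem_jIdeal_of_mem_commIdeal p F (uemb_mem_commIdeal p F hy)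
      · change uemb p F L _ ∈ jIdeal p F L
        rw [uemb_pmap]
        exact pow_mem_jIdeal_of_mem_jIdeal p F hx
    · rw [Submodule.mem_comap, uemb_lie]
      exact sub_mem (omega_mul_derived_mem p F (uemb_mem_omegaIdeal p F x) hy)
        (derived_mul_omega_mem p F (uemb_mem_omegaIdeal p F x) hy)
  exact hle hx

/-- An augmentation-preserving isomorphism maps `J_L` into `J_H`. -/
theorem map_jIdeal_le {H : Type*} [LieRing H] [LieAlgebra F H] [RestrictedLieAlgebra p F H]
    (f : uEnv p F L →ₐ[F] uEnv p F H)
    (hf : ∀ a ∈ omegaIdeal p F L, f a ∈ omegaIdeal p F H) {a : uEnv p F L}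
    (ha : a ∈ jIdeal p F L) : f a ∈ jIdeal p F H := by
  have hder : ∀ l ∈ derivedSub F L, f (uemb p F L l) ∈ commIdeal p F H := by
    refine fun l hl => derivedSub_le F
      (N := (commIdeal p F H).comap (f.toLinearMap ∘ₗ uemb p F L)) (fun x y => ?_) hl
    simp only [Submodule.mem_comap, LinearMap.comp_apply, AlgHom.toLinearMap_apply, uemb_lie,
      map_sub, map_mul]
    exact commutator_mem_commIdeal p F _ _
  refine jIdeal_le p F (N := (jIdeal p F H).comap f.toLinearMap) (fun w hw l hl => ?_)
    (fun w hw l hl => ?_) ha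
  · simpa using omega_mul_commIdeal_mem p F (hder l hl) (hf w hw)
  · simpa using commIdeal_mul_omega_mem p F (hder l hl) (hf w hw)

end Ideals

/-- Every alternating bilinear form is the antisymmetrisation of a bilinear form, in any
characteristic. -/
theorem exists_sub_flip_eq_of_isAlt {F V : Type*} [Field F] [AddCommGroup V] [Module F V]
    [FiniteDimensional F V] (b : V →ₗ[F] V →ₗ[F] F) (hb : b.IsAlt) :
    ∃ β : V →ₗ[F] V →ₗ[F] F, ∀ x y, β x y - β y x = b x y := by
  let v := Module.finBasis F V
  let β : V →ₗ[F] V →ₗ[F] F :=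
    v.constr F fun i => v.constr F fun j => if i < j then b (v i) (v j) else 0
  have h : β - β.flip = b := by
    refine v.ext fun i => v.ext fun j => ?_
    simp only [β, LinearMap.sub_apply, LinearMap.flip_apply, Module.Basis.constr_basis]
    rcases lt_trichotomy i j with h | rfl | h
    · simp [h, h.not_gt]
    · simpa using (hb (v i)).symm
    · simp [h, h.not_gt, ← hb.neg (v i) (v j)]
  exact ⟨β, fun x y => DFunLike.congr_fun (DFunLike.congr_fun h x) y⟩

/-- The truncated polynomial algebra `F[t]/(t^(K+1))`, with its augmentation and the coefficient
of `t^K`. -/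
theorem exists_truncated_polynomial_algebra.{u} {F : Type u} [Field F] (K : ℕ) :
    ∃ (D : Type u) (_ : CommRing D) (_ : Algebra F D) (ε : D →ₐ[F] F) (t : D) (κ : D →ₗ[F] F),
      (∀ d, d * t ^ K = ε d • t ^ K) ∧ ε t = 0 ∧ t ^ (K + 1) = 0 ∧ κ (t ^ K) = 1 ∧
      ∀ i < K, κ (t ^ i) = 0 := by
  let I : Ideal (Polynomial F) := Ideal.span {Polynomial.X ^ (K + 1)}
  have hI : ∀ f ∈ I, ∀ i ≤ K, Polynomial.coeff f i = 0 := fun f hf i hi =>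
    Polynomial.X_pow_dvd_iff.1 (Ideal.mem_span_singleton.1 hf) i (Nat.lt_succ_of_le hi)
  let ε : (Polynomial F ⧸ I) →ₐ[F] F := Ideal.Quotient.liftₐ I (Polynomial.aeval 0) fun f hf => by
    rw [← Polynomial.coeff_zero_eq_aeval_zero]; exact hI f hf 0 (Nat.zero_le _)
  let κ : (Polynomial F ⧸ I) →ₗ[F] F :=
    (I.restrictScalars F).liftQ (Polynomial.lcoeff F K) fun f hf => hI f hf K le_rfl
  have hκ : ∀ f, κ (Ideal.Quotient.mk I f) = f.coeff K := fun f => rfl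
  have hε : ∀ f, ε (Ideal.Quotient.mk I f) = f.coeff 0 := fun f =>
    (Polynomial.coeff_zero_eq_aeval_zero f).symm
  have ht : (Ideal.Quotient.mk I Polynomial.X) ^ (K + 1) = 0 := by
    rw [← map_pow]; exact Ideal.Quotient.eq_zero_iff_mem.2 (Ideal.mem_span_singleton_self _)
  refine ⟨Polynomial F ⧸ I, inferInstance, inferInstance, ε, Ideal.Quotient.mk I Polynomial.X, κ,
    fun d => ?_, ?_, ht, ?_, fun i hi => ?_⟩
  · obtain ⟨f, rfl⟩ := Ideal.Quotient.mk_surjective d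
    have hf : Ideal.Quotient.mk I f
        = Ideal.Quotient.mk I Polynomial.X * Ideal.Quotient.mk I f.divX
          + algebraMap F _ (f.coeff 0) := by
      conv_lhs => rw [← Polynomial.X_mul_divX_add f]
      rw [map_add, map_mul]; rfl
    rw [hε, Algebra.smul_def]
    conv_lhs => rw [hf]
    rw [add_mul, mul_right_comm, ← pow_succ', ht, zero_mul, zero_add]
  · rw [hε, Polynomial.coeff_X_zero]
  · rw [← map_pow, hκ, Polynomial.coeff_X_pow_self]
  · rw [← map_pow, hκ, Polynomial.coeff_X_pow, if_neg hi.ne']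

section TwistedRegularRep

variable {F L V D : Type*} [Field F] [AddCommGroup L] [Module F L] [AddCommGroup V] [Module F V]
  [CommRing D] [Algebra F D]

/-- The linear family of operators `(g, v) ↦ (f(x) g + β(a x, v) τ, ε(g) a x)` on `D × V`. -/
def twistedRep (ε : D →ₐ[F] F) (τ : D) (a : L →ₗ[F] V) (β : V →ₗ[F] V →ₗ[F] F) (f : L →ₗ[F] D) :
    L →ₗ[F] Module.End F (D × V) :=
  LinearMap.mk₂ F (fun x gv => (f x * gv.1 + β (a x) gv.2 • τ, ε gv.1 • a x))
    (fun x y gv => by ext <;> simp [add_mul, add_smul]; abel)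
    (fun c x gv => by ext <;> simp [smul_smul, mul_comm])
    (fun x gv gv' => by ext <;> simp [mul_add, add_smul]; abel)
    (fun c x gv => by ext <;> simp [smul_smul])

variable {ε : D →ₐ[F] F} {τ : D} {a : L →ₗ[F] V} {β : V →ₗ[F] V →ₗ[F] F} {f : L →ₗ[F] D}

theorem twistedRep_apply (x : L) (gv : D × V) :
    twistedRep ε τ a β f x gv = (f x * gv.1 + β (a x) gv.2 • τ, ε gv.1 • a x) := rfl

theorem twistedRep_mul_apply (hτ : ∀ d, d * τ = ε d • τ) (hτ₀ : ε τ = 0) (hf : ∀ x, ε (f x) = 0)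
    (x y : L) (gv : D × V) :
    twistedRep ε τ a β f x (twistedRep ε τ a β f y gv)
      = (f x * f y * gv.1 + (ε gv.1 * β (a x) (a y)) • τ, 0) := by
  simp only [twistedRep_apply]
  ext
  · simp [mul_add, hτ, hf, mul_assoc]
  · simp [hf, hτ₀]

theorem twistedRep_pow_apply (hτ : ∀ d, d * τ = ε d • τ) (hτ₀ : ε τ = 0) (hf : ∀ x, ε (f x) = 0)
    (x : L) (gv : D × V) {n : ℕ} (hn : 2 ≤ n) :
    (twistedRep ε τ a β f x ^ n) gv
      = (f x ^ n * gv.1 + (ε gv.1 * if n = 2 then β (a x) (a x) else 0) • τ, 0) := by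
  induction n, hn using Nat.le_induction with
  | base => simp [pow_two, twistedRep_mul_apply hτ hτ₀ hf]
  | succ n hn ih =>
    rw [pow_succ', Module.End.mul_apply, ih, twistedRep_apply]
    ext
    · simp [mul_add, hτ, hf, pow_succ', mul_assoc, show n + 1 ≠ 2 by omega]
    · simp only [map_add, map_mul, map_pow, map_smul, hf, hτ₀, smul_zero,
        zero_pow (show n ≠ 0 by omega), zero_mul, add_zero, zero_smul]

end TwistedRegularRep

section Detection

variable (p : ℕ) {F L V : Type*} [Field F] [LieRing L] [LieAlgebra F L]
  [AddCommGroup V] [Module F V]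

theorem twistedRep_lie {D : Type*} [CommRing D] [Algebra F D]
    {ε : D →ₐ[F] F} {τ : D} {a : L →ₗ[F] V} {β : V →ₗ[F] V →ₗ[F] F} {f : L →ₗ[F] D}
    (hτ : ∀ d, d * τ = ε d • τ) (hτ₀ : ε τ = 0) (hf : ∀ x, ε (f x) = 0)
    (ha : ∀ x y : L, a ⁅x, y⁆ = 0)
    (hlie : ∀ x y : L, f ⁅x, y⁆ = (β (a x) (a y) - β (a y) (a x)) • τ) (x y : L) :
    twistedRep ε τ a β f ⁅x, y⁆
      = twistedRep ε τ a β f x * twistedRep ε τ a β f y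
        - twistedRep ε τ a β f y * twistedRep ε τ a β f x := by
  refine LinearMap.ext fun gv => ?_
  rw [LinearMap.sub_apply, Module.End.mul_apply, Module.End.mul_apply,
    twistedRep_mul_apply hτ hτ₀ hf, twistedRep_mul_apply hτ hτ₀ hf, twistedRep_apply, ha, hlie]
  ext
  · simp only [map_zero, LinearMap.zero_apply, zero_smul, add_zero, Prod.fst_sub]
    rw [smul_mul_assoc, mul_comm τ, hτ, smul_smul, mul_comm (f x) (f y), add_sub_add_left_eq_sub,
      ← sub_smul]
    congr 1
    ring
  · simp

/-- Over a perfect field, a `p`-semilinear functional has a linear `p`-th root. -/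
theorem exists_linear_pow_eq [Fact p.Prime] [CharP F p] [PerfectField F] (μ : L → F)
    (hadd : ∀ x y, μ (x + y) = μ x + μ y) (hsmul : ∀ (c : F) x, μ (c • x) = c ^ p * μ x) :
    ∃ ν : L →ₗ[F] F, ∀ x, ν x ^ p = μ x := by
  have : PerfectRing F p := PerfectField.toPerfectRing p
  refine ⟨{ toFun := fun x => (frobeniusEquiv F p).symm (μ x)
            map_add' := fun x y => by rw [hadd, map_add]
            map_smul' := fun c x => ?_ }, fun x => ?_⟩
  · rw [hsmul, map_mul, ← frobeniusEquiv_def, RingEquiv.symm_apply_apply]; rfl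
  · change ((frobeniusEquiv F p).symm (μ x)) ^ p = μ x
    rw [← frobeniusEquiv_def, RingEquiv.apply_symm_apply]

variable [RestrictedLieAlgebra p F L]

variable (F L) in
theorem exists_iterate_pmap_eq_zero (hL : IsPNilpotent p F L) :
    ∃ s : ℕ, ∀ x : L, (pmap p F L)^[s] x = 0 := by
  obtain ⟨s, hs⟩ := hL
  refine ⟨s, fun x => ?_⟩
  have h : ∀ k, (pmap p F L)^[k] x ∈ (subPPow p F)^[k] (⊤ : LieSubalgebra F L) := by
    intro k
    induction k with
    | zero => trivial
    | succ k ih =>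
      rw [Function.iterate_succ_apply', Function.iterate_succ_apply']
      exact subset_restrictedClosure p F _ ⟨_, ih, rfl⟩
  have := h s
  rw [hs] at this
  exact this

variable [Fact p.Prime]

/-- The defect of additivity of `x ↦ λ(x^[p])` for a functional `λ` that factors through a Lie
algebra of class two. -/
theorem pmap_form_add (lam : L →ₗ[F] F) (a : L →ₗ[F] V) (β : V →ₗ[F] V →ₗ[F] F)
    (ha : ∀ x y : L, a ⁅x, y⁆ = 0)
    (hlam : ∀ x y : L, lam ⁅x, y⁆ = β (a x) (a y) - β (a y) (a x)) (x y : L) :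
    lam (pmap p F L (x + y)) - (if p = 2 then β (a (x + y)) (a (x + y)) else 0)
      = (lam (pmap p F L x) - (if p = 2 then β (a x) (a x) else 0))
        + (lam (pmap p F L y) - (if p = 2 then β (a y) (a y) else 0)) := by
  have hp2 := (Fact.out : p.Prime).two_le
  obtain ⟨D, _, _, ε, t, κ, hτ, ht₀, ht, hκ, -⟩ :=
    exists_truncated_polynomial_algebra (F := F) 1
  rw [pow_one] at *
  let f : L →ₗ[F] D := lam.smulRight t
  have hfx : ∀ x, f x = lam x • t := fun x => rfl
  have hf : ∀ x, ε (f x) = 0 := fun x => by simp [f, ht₀]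
  have hfp : ∀ x, f x ^ p = 0 := fun x => by
    simp only [f, LinearMap.smulRight_apply, smul_pow]
    rw [pow_eq_zero_of_le hp2 ht, smul_zero]
  have h := map_pmap_add p F L (twistedRep ε t a β f)
    (twistedRep_lie (D := D) hτ ht₀ hf ha fun x y => by simp [f, hlam]) x y
  have h' := congrArg κ (congrArg Prod.fst (LinearMap.congr_fun h (1, 0)))
  rw [← map_add (twistedRep ε t a β f)] at h'
  simp only [LinearMap.sub_apply, twistedRep_pow_apply hτ ht₀ hf _ _ hp2, twistedRep_apply, hfp,
    Prod.fst_sub, map_sub, zero_add, map_one, one_mul, mul_one, map_zero, zero_smul,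
    add_zero] at h'
  simp only [hfx, map_smul, hκ, smul_eq_mul, mul_one] at h'
  linear_combination h'

variable [CharP F p] [PerfectField F]

/-- A functional vanishing on `L'_p` has a linear `p`-th root along the `p`-map. -/
theorem exists_pow_eq_pmap (lam : L →ₗ[F] F) (h : ∀ x ∈ derivedP p F L, lam x = 0) :
    ∃ ν : L →ₗ[F] F, (∀ x, ν x ^ p = lam (pmap p F L x)) ∧ ∀ x ∈ derivedP p F L, ν x = 0 := by
  obtain ⟨ν, hν⟩ := exists_linear_pow_eq p (fun x => lam (pmap p F L x))
    (fun x y => by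
      simpa using pmap_form_add p lam (0 : L →ₗ[F] L) 0 (by simp)
        (fun x y => by simpa using h _ (derivedSub_le_derivedP p F (lie_mem_derivedSub F x y))) x y)
    (fun c x => by simp only [pmap, RestrictedLieAlgebra.pOp_smul, map_smul, smul_eq_mul])
  refine ⟨ν, hν, fun x hx => ?_⟩
  have := hν x
  rw [h _ (pmap_mem_derivedP p F hx)] at this
  exact pow_eq_zero_iff (Fact.out : p.Prime).ne_zero |>.1 this

/-- A sequence of iterated `p`-th roots of a functional along the `p`-map; it terminates by
`p`-nilpotency. -/
theorem exists_root_sequence (hL : IsPNilpotent p F L) (nu : L →ₗ[F] F)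
    (h : ∀ x ∈ derivedP p F L, nu x = 0) :
    ∃ (r : ℕ → L →ₗ[F] F) (N : ℕ), r 0 = nu ∧
      (∀ k, ∀ x ∈ derivedP p F L, r k x = 0) ∧
      (∀ k x, r (k + 1) x ^ p = r k (pmap p F L x)) ∧ ∀ x, r N x = 0 := by
  choose g hg using fun ν : {ν : L →ₗ[F] F // ∀ x ∈ derivedP p F L, ν x = 0} =>
    exists_pow_eq_pmap p ν.1 ν.2
  let T : {ν : L →ₗ[F] F // ∀ x ∈ derivedP p F L, ν x = 0} →
      {ν : L →ₗ[F] F // ∀ x ∈ derivedP p F L, ν x = 0} := fun ν => ⟨g ν, (hg ν).2⟩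
  have hT : ∀ k x, (T^[k + 1] ⟨nu, h⟩).1 x ^ p = (T^[k] ⟨nu, h⟩).1 (pmap p F L x) := by
    intro k x
    rw [Function.iterate_succ_apply']
    exact (hg _).1 x
  obtain ⟨s, hs⟩ := exists_iterate_pmap_eq_zero p F L hL
  refine ⟨fun k => (T^[k] ⟨nu, h⟩).1, s, rfl, fun k => (T^[k] ⟨nu, h⟩).2, hT, fun x => ?_⟩
  have hpow : ∀ k x, (T^[k] ⟨nu, h⟩).1 x ^ p ^ k = nu ((pmap p F L)^[k] x) := by
    intro k
    induction k with
    | zero => intro x; simp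
    | succ k ih => intro x; rw [pow_succ', pow_mul, hT, ih, ← Function.iterate_succ_apply]
  have := hpow s x
  rw [hs, map_zero] at this
  exact pow_eq_zero_iff (pow_ne_zero _ (Fact.out : p.Prime).ne_zero) |>.1 this

/-- `L ∩ J_L ⊆ L'^p + γ₃(L)`. -/
theorem mem_mainIdeal_of_uemb_mem_jIdeal [FiniteDimensional F L] (hL : IsPNilpotent p F L) {z : L}
    (hz : uemb p F L z ∈ jIdeal p F L) : z ∈ mainIdeal p F L := by
  have hp := (Fact.out : p.Prime)
  by_contra hcon
  obtain ⟨lam, hlamz, hlam⟩ := Submodule.exists_le_ker_of_notMem hcon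
  apply hlamz
  let b : L →ₗ[F] L →ₗ[F] F := LinearMap.compr₂ (LieModule.toEnd F L L).toLinearMap lam
  have hb : ∀ x y, b x y = lam ⁅x, y⁆ := fun x y => rfl
  obtain ⟨β, hβ⟩ := exists_sub_flip_eq_of_isAlt b (fun x => by simp [hb])
  obtain ⟨σ, hσ⟩ := LinearMap.exists_rightInverse_of_surjective (LinearMap.ker b).mkQ
    (Submodule.range_mkQ _)
  let a : L →ₗ[F] L := σ ∘ₗ (LinearMap.ker b).mkQ
  have haker : ∀ x, x ∈ LinearMap.ker b → a x = 0 := fun x hx => by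
    simp [a, (Submodule.Quotient.mk_eq_zero _).2 hx]
  have hba : ∀ x, b (a x) = b x := fun x => by
    rw [← sub_eq_zero, ← map_sub, ← LinearMap.mem_ker, ← Submodule.Quotient.mk_eq_zero,
      Submodule.Quotient.mk_sub, sub_eq_zero]
    exact LinearMap.congr_fun hσ (Submodule.Quotient.mk x)
  have hsymm : ∀ x y, b x y = - b y x := fun x y => by
    rw [hb, hb, ← map_neg, lie_skew]
  have hβa : ∀ x y : L, lam ⁅x, y⁆ = β (a x) (a y) - β (a y) (a x) := fun x y => by
    rw [hβ, hba, hsymm, hba, ← hsymm, hb]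
  have ha : ∀ x y : L, a ⁅x, y⁆ = 0 := fun x y => haker _ <| LinearMap.mem_ker.2 <|
    LinearMap.ext fun w => by
      rw [hsymm, hb]
      simpa using hlam (lie_mem_mainIdeal p F w (lie_mem_derivedSub F x y))
  have hap : ∀ x : L, a (pmap p F L x) = 0 := fun x => haker _ <| LinearMap.mem_ker.2 <|
    LinearMap.ext fun w => by
      obtain ⟨k, hk⟩ := Nat.exists_eq_add_of_le' hp.two_le
      have h : ⁅pmap p F L x, w⁆ = ⁅x, ⁅x, ((LieAlgebra.ad F L x) ^ k) w⁆⁆ := by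
        rw [pmap, RestrictedLieAlgebra.ad_pOp]
        conv_lhs => rw [hk, pow_succ', pow_succ']
        rfl
      rw [hb, h]
      exact hlam (lie_mem_mainIdeal p F x (lie_mem_derivedSub F _ _))
  have haD : ∀ x ∈ derivedP p F L, a x = 0 :=
    fun x hx => derivedP_le p F (N := LinearMap.ker a) ha (fun x _ => hap x) hx
  obtain ⟨nu, hnu⟩ := exists_linear_pow_eq p
    (fun x => lam (pmap p F L x) - (if p = 2 then β (a x) (a x) else 0))
    (pmap_form_add p lam a β ha hβa) (fun c x => by
      simp only [pmap, RestrictedLieAlgebra.pOp_smul, map_smul, smul_eq_mul,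
        LinearMap.smul_apply]
      split_ifs with h2
      · subst h2; ring
      · ring)
  have hnuD : ∀ x ∈ derivedP p F L, nu x = 0 := fun x hx => by
    have := hnu x
    rw [show lam (pmap p F L x) = 0 from hlam (pmap_mem_mainIdeal p F hx), haD x hx] at this
    simpa [hp.ne_zero] using this
  obtain ⟨r, N, hr₀, hrD, hr, hrN⟩ := exists_root_sequence p hL nu hnuD
  have hpos : ∀ k, 0 < p ^ k := fun k => pow_pos hp.pos k
  obtain ⟨D, _, _, ε, t, κ, hτ, ht₀, ht, hκ, hκ'⟩ :=
    exists_truncated_polynomial_algebra (F := F) (p ^ N)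
  have hετ : ε (t ^ p ^ N) = 0 := by rw [map_pow, ht₀, zero_pow (hpos N).ne']
  let f : L →ₗ[F] D := lam.smulRight (t ^ p ^ N)
    + ∑ k ∈ Finset.range N, (r k).smulRight (t ^ p ^ (N - 1 - k))
  have hfx : ∀ x, f x = lam x • t ^ p ^ N
      + ∑ k ∈ Finset.range N, r k x • t ^ p ^ (N - 1 - k) := fun x => by
    simp [f, LinearMap.sum_apply]
  have hf : ∀ x, ε (f x) = 0 := fun x => by
    rw [hfx, map_add, map_smul, hετ, map_sum, smul_zero, zero_add]
    exact Finset.sum_eq_zero fun k _ => by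
      rw [map_smul, map_pow, ht₀, zero_pow (hpos _).ne', smul_zero]
  have hfD : ∀ x ∈ derivedP p F L, f x = lam x • t ^ p ^ N := fun x hx => by
    rw [hfx, Finset.sum_eq_zero fun k _ => by rw [hrD k x hx, zero_smul], add_zero]
  have : Nontrivial D := ⟨t ^ p ^ N, 0, fun h => by rw [h, map_zero] at hκ; exact zero_ne_one hκ⟩
  have : CharP D p := charP_of_injective_algebraMap (algebraMap F D).injective p
  have hfp : ∀ x, f (pmap p F L x)
      = f x ^ p + (if p = 2 then β (a x) (a x) else 0) • t ^ p ^ N := fun x => by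
    have hlam' : lam (pmap p F L x) = nu x ^ p + (if p = 2 then β (a x) (a x) else 0) := by
      rw [hnu]; ring
    have htop : (lam x • t ^ p ^ N) ^ p = 0 := by
      rw [smul_pow, ← pow_mul, pow_eq_zero_of_le _ ht, smul_zero]
      nlinarith [hp.two_le, hpos N]
    have hsum : nu x ^ p • t ^ p ^ N
        + ∑ k ∈ Finset.range N, r k (pmap p F L x) • t ^ p ^ (N - 1 - k)
        = ∑ k ∈ Finset.range N, (r k x • t ^ p ^ (N - 1 - k)) ^ p := by
      have h1 : ∀ k ∈ Finset.range N, (r k x • t ^ p ^ (N - 1 - k)) ^ p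
          = r k x ^ p • t ^ p ^ (N - k) := fun k hk => by
        rw [smul_pow, ← pow_mul, ← pow_succ]
        congr 3
        have := Finset.mem_range.1 hk
        omega
      rw [Finset.sum_congr rfl h1, ← hr₀]
      have h2 := Finset.sum_range_succ (fun k => r k x ^ p • t ^ p ^ (N - k)) N
      have h3 := Finset.sum_range_succ' (fun k => r k x ^ p • t ^ p ^ (N - k)) N
      rw [hrN, zero_pow hp.ne_zero, zero_smul, add_zero] at h2
      rw [← h2, h3, add_comm]
      congr 1
      refine Finset.sum_congr rfl fun k _ => ?_
      rw [hr, Nat.sub_sub, add_comm 1 k]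
    rw [hfx, hfx, add_pow_char, sum_pow_char, htop, zero_add, ← hsum, hlam', add_smul]
    abel
  obtain ⟨g, hg⟩ := exists_uEnv_lift p F L (twistedRep ε (t ^ p ^ N) a β f)
    (twistedRep_lie (D := D) hτ hετ hf ha fun x y => by
      rw [hfD _ (derivedSub_le_derivedP p F (lie_mem_derivedSub F x y)), hβa])
    (fun x => LinearMap.ext fun gv => by
      rw [twistedRep_pow_apply hτ hετ hf _ _ hp.two_le, twistedRep_apply, hap, hfp]
      ext
      · simp only [map_zero, LinearMap.zero_apply, zero_smul, add_zero, add_mul]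
        rw [smul_mul_assoc, mul_comm (t ^ p ^ N), hτ, smul_smul, mul_comm (ε gv.1)]
      · simp)
  have hgD : ∀ l ∈ derivedSub F L, ∀ gv,
      g (uemb p F L l) gv = ((ε gv.1 * lam l) • t ^ p ^ N, 0) := by
    intro l hl gv
    have hl' := derivedSub_le_derivedP p F hl
    rw [hg, twistedRep_apply, hfD l hl', haD l hl']
    ext
    · simp only [map_zero, LinearMap.zero_apply, zero_smul, add_zero]
      rw [smul_mul_assoc, mul_comm (t ^ p ^ N), hτ, smul_smul, mul_comm]
    · simp
  have hgω : ∀ w : uEnv p F L, ∀ gv, ε (g w gv).1 = aug p F L w * ε gv.1 := by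
    intro w
    induction w using uEnv_induction with
    | hx x => intro gv; rw [hg, twistedRep_apply, aug_uemb]; simp [hf, hετ, -map_pow]
    | hc c => intro gv; simp [Algebra.algebraMap_eq_smul_one]
    | hadd w w' h h' =>
      intro gv
      rw [map_add, LinearMap.add_apply, Prod.fst_add, map_add, h, h', map_add, add_mul]
    | hmul w w' h h' => intro gv; rw [map_mul, Module.End.mul_apply, h, h', map_mul, mul_assoc]
  have hgτ : ∀ w : uEnv p F L, ∀ c : F, g w (c • t ^ p ^ N, 0)
      = ((aug p F L w * c) • t ^ p ^ N, 0) := by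
    intro w
    induction w using uEnv_induction with
    | hx x =>
      intro c
      rw [hg, twistedRep_apply, aug_uemb]
      ext
      · simp [hτ, hf]
      · simp [hετ, -map_pow]
    | hc r => intro c; simp [Algebra.algebraMap_eq_smul_one, smul_smul]
    | hadd w w' h h' =>
      intro c
      rw [map_add, LinearMap.add_apply, h, h', map_add, Prod.mk_add_mk, add_mul, add_smul, add_zero]
    | hmul w w' h h' => intro c; rw [map_mul, Module.End.mul_apply, h', h, map_mul, mul_assoc]
  have hJ : jIdeal p F L ≤ LinearMap.ker g.toLinearMap := by
    refine jIdeal_le p F (fun w hw l hl => ?_) (fun w hw l hl => ?_)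
    · refine LinearMap.mem_ker.2 (LinearMap.ext fun gv => ?_)
      rw [AlgHom.toLinearMap_apply, map_mul, Module.End.mul_apply, hgD l hl, hgτ,
        (mem_omegaIdeal p F).1 hw]
      simp
    · refine LinearMap.mem_ker.2 (LinearMap.ext fun gv => ?_)
      rw [AlgHom.toLinearMap_apply, map_mul, Module.End.mul_apply, hgD l hl, hgω,
        (mem_omegaIdeal p F).1 hw]
      simp
  have h0 : g (uemb p F L z) = 0 := hJ hz
  have h1 := congrArg κ (congrArg Prod.fst (LinearMap.congr_fun h0 (1, 0)))
  rw [hg, twistedRep_apply] at h1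
  have h2 : κ (f z) = 0 := by simpa using h1
  rw [hfx, map_add, map_smul, hκ, map_sum, Finset.sum_eq_zero] at h2
  · simpa using h2
  · intro k hk
    have := Finset.mem_range.1 hk
    rw [map_smul, hκ' _ (Nat.pow_lt_pow_right hp.one_lt (by omega)), smul_zero]

end Detection

section Products

variable (p : ℕ) (F : Type*) [Field F] [Fact p.Prime]
variable {L : Type*} [LieRing L] [LieAlgebra F L] [RestrictedLieAlgebra p F L]

theorem list_prod_mem_omegaIdeal {l : List (uEnv p F L)} (hl : ∀ a ∈ l, a ∈ omegaIdeal p F L)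
    (hne : l ≠ []) : l.prod ∈ omegaIdeal p F L := by
  cases l with
  | nil => exact absurd rfl hne
  | cons a l =>
    rw [List.prod_cons]
    exact mul_mem_omegaIdeal_right p F _ (hl a List.mem_cons_self)

theorem prod_sub_prod_mem_commIdeal {l₁ l₂ : List (uEnv p F L)} (h : l₁.Perm l₂) :
    l₁.prod - l₂.prod ∈ commIdeal p F L := by
  induction h with
  | nil => simp
  | cons a _ ih =>
    rw [List.prod_cons, List.prod_cons, ← mul_sub]
    exact commIdeal_mul_mem_left p F a ih
  | swap a b l =>
    simp only [List.prod_cons, ← mul_assoc]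
    rw [← sub_mul]
    exact commIdeal_mul_mem_right p F _ (commutator_mem_commIdeal p F b a)
  | trans _ _ h₁ h₂ =>
    rw [← sub_add_sub_cancel]
    exact add_mem h₁ h₂

theorem prod_sub_prod_mem_jIdeal {l₁ l₂ : List (uEnv p F L)} (h : l₁.Perm l₂)
    (hω : ∀ a ∈ l₁, a ∈ omegaIdeal p F L) (hlen : 3 ≤ l₁.length) :
    l₁.prod - l₂.prod ∈ jIdeal p F L := by
  induction h with
  | nil => simp
  | cons a h _ =>
    rw [List.prod_cons, List.prod_cons, ← mul_sub]
    exact omega_mul_commIdeal_mem p F (prod_sub_prod_mem_commIdeal p F h)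
      (hω a List.mem_cons_self)
  | swap a b l =>
    simp only [List.prod_cons, ← mul_assoc]
    rw [← sub_mul]
    refine commIdeal_mul_omega_mem p F (commutator_mem_commIdeal p F b a)
      (list_prod_mem_omegaIdeal p F (fun c hc => hω c (by simp [hc])) ?_)
    rintro rfl
    simp at hlen
  | trans h h' h₁ h₂ =>
    rw [← sub_add_sub_cancel]
    exact add_mem (h₁ hω hlen)
      (h₂ (fun a ha => hω a (h.mem_iff.2 ha)) (h.length_eq ▸ hlen))

theorem prod_sub_prod_mem_jIdeal_of_commute {l₁ l₂ : List (uEnv p F L)} (h : l₁.Perm l₂)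
    (hc : ∀ a ∈ l₁, ∀ b ∈ l₁, a * b - b * a ∈ jIdeal p F L) :
    l₁.prod - l₂.prod ∈ jIdeal p F L := by
  induction h with
  | nil => simp
  | cons a _ ih =>
    rw [List.prod_cons, List.prod_cons, ← mul_sub]
    exact jIdeal_mul_mem_left p F a _
      (ih fun b hb c hc' => hc b (List.mem_cons_of_mem _ hb) c (List.mem_cons_of_mem _ hc'))
  | swap a b l =>
    simp only [List.prod_cons, ← mul_assoc]
    rw [← sub_mul]
    exact jIdeal_mul_mem_right p F _ _ (hc b (by simp) a (by simp))
  | trans h _ h₁ h₂ =>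
    rw [← sub_add_sub_cancel]
    exact add_mem (h₁ hc)
      (h₂ fun a ha b hb => hc a (h.mem_iff.2 ha) b (h.mem_iff.2 hb))

theorem prod_map_sub_prod_map_mem_commIdeal {ι : Type*} {f g : ι → uEnv p F L}
    (h : ∀ i, f i - g i ∈ commIdeal p F L) (s : List ι) :
    (s.map f).prod - (s.map g).prod ∈ commIdeal p F L := by
  induction s with
  | nil => simp
  | cons i s ih =>
    simp only [List.map_cons, List.prod_cons]
    rw [show ∀ a b c d : uEnv p F L, a * b - c * d = a * (b - d) + (a - c) * d by
      intros; noncomm_ring]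
    exact add_mem (commIdeal_mul_mem_left p F _ ih) (commIdeal_mul_mem_right p F _ (h i))

theorem prod_map_sub_prod_map_mem_jIdeal {ι : Type*} {f g : ι → uEnv p F L}
    (hf : ∀ i, f i ∈ omegaIdeal p F L) (hg : ∀ i, g i ∈ omegaIdeal p F L)
    (h : ∀ i, f i - g i ∈ commIdeal p F L) {s : List ι} (hs : 2 ≤ s.length) :
    (s.map f).prod - (s.map g).prod ∈ jIdeal p F L := by
  cases s with
  | nil => simp at hs
  | cons i s =>
    simp only [List.map_cons, List.prod_cons]
    rw [show ∀ a b c d : uEnv p F L, a * b - c * d = a * (b - d) + (a - c) * d by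
      intros; noncomm_ring]
    refine add_mem (omega_mul_commIdeal_mem p F
      (prod_map_sub_prod_map_mem_commIdeal p F h s) (hf i))
      (commIdeal_mul_omega_mem p F (h i) (list_prod_mem_omegaIdeal p F ?_ ?_))
    · simpa using fun i _ => hg i
    · rintro h
      simp_all

theorem pow_sub_pow_mem_commIdeal {a b : uEnv p F L} (h : a - b ∈ commIdeal p F L) (k : ℕ) :
    a ^ k - b ^ k ∈ commIdeal p F L := by
  simpa using prod_map_sub_prod_map_mem_commIdeal p F (f := fun _ : Unit => a)
    (g := fun _ => b) (fun _ => h) (List.replicate k ())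

/-- The `p`-th power map is additive modulo `J_L` on elements commuting modulo `J_L`. -/
theorem add_pow_sub_mem_jIdeal [CharP F p] {a b : uEnv p F L}
    (h : a * b - b * a ∈ jIdeal p F L) : (a + b) ^ p - a ^ p - b ^ p ∈ jIdeal p F L := by
  let I : Ideal (uEnv p F L) :=
    { (jIdeal p F L).toAddSubmonoid with
      smul_mem' := fun c x hx => jIdeal_mul_mem_left p F c x hx }
  have : I.IsTwoSided := ⟨fun {x} c hx => jIdeal_mul_mem_right p F c x hx⟩
  have hc : Commute (Ideal.Quotient.mk I a) (Ideal.Quotient.mk I b) := by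
    rw [commute_iff_eq, ← map_mul, ← map_mul]
    exact Ideal.Quotient.eq.2 h
  obtain ⟨r, hr⟩ := hc.exists_add_pow_prime_eq (Fact.out : p.Prime)
  have hp : (p : uEnv p F L ⧸ I) = 0 := by
    have : (p : uEnv p F L) = 0 := by
      rw [← map_natCast (algebraMap F (uEnv p F L)), CharP.cast_eq_zero, map_zero]
    rw [← map_natCast (Ideal.Quotient.mk I), this, map_zero]
  rw [hp] at hr
  have h0 : Ideal.Quotient.mk I ((a + b) ^ p - a ^ p - b ^ p) = 0 := by
    simp only [map_sub, map_pow, map_add, hr]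
    simp
  exact Ideal.Quotient.eq_zero_iff_mem.1 h0

end Products

section Monomials

variable (p : ℕ) (F : Type*) [Field F]
variable {L : Type*} [LieRing L] [LieAlgebra F L] [RestrictedLieAlgebra p F L]
variable {n : ℕ} {ex : Fin n → ℕ} (X : (i : Fin n) → Fin (ex i) → L)

/-- The product in `u(L)` of the representatives `X` along a list of indices. -/
def wordProd (s : List (Σ i : Fin n, Fin (ex i))) : uEnv p F L :=
  (s.map fun q => uemb p F L (X q.1 q.2)).prod

/-- The weakly increasing list of indices with prescribed multiplicities. -/
def sortedWord (a : (i : Fin n) → Fin (ex i) → ℕ) : List (Σ i : Fin n, Fin (ex i)) :=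
  (List.finRange n).flatMap fun i =>
    (List.finRange (ex i)).flatMap fun j => List.replicate (a i j) ⟨i, j⟩

theorem wordProd_sortedWord (a : (i : Fin n) → Fin (ex i) → ℕ) :
    wordProd p F X (sortedWord a) = ((List.finRange n).map (fun i =>
      ((List.finRange (ex i)).map (fun j => uemb p F L (X i j) ^ a i j)).prod)).prod := by
  simp only [wordProd, sortedWord, List.flatMap, List.map_flatten, List.prod_flatten, List.map_map,
    Function.comp_def, List.map_replicate, List.prod_replicate]

theorem length_sortedWord (a : (i : Fin n) → Fin (ex i) → ℕ) :
    (sortedWord a).length = ∑ i, ∑ j, a i j := by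
  simp only [sortedWord, List.length_flatMap, List.length_replicate, Fin.sum_univ_def]

theorem count_sortedWord (a : (i : Fin n) → Fin (ex i) → ℕ) (q : Σ i : Fin n, Fin (ex i)) :
    (sortedWord a).count q = a q.1 q.2 := by
  obtain ⟨i, j⟩ := q
  simp only [sortedWord, List.count_flatMap, Function.comp_def, ← Fin.sum_univ_def,
    List.count_replicate]
  rw [Finset.sum_eq_single i, Finset.sum_eq_single j]
  · simp
  · intro j' _ hj
    simp [hj]
  · simp
  · intro i' _ hi
    refine Finset.sum_eq_zero fun j' _ => ?_
    simp [hi]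
  · simp

theorem perm_sortedWord_count (s : List (Σ i : Fin n, Fin (ex i))) :
    s.Perm (sortedWord fun i j => s.count ⟨i, j⟩) :=
  List.perm_iff_count.2 fun q =>
    (count_sortedWord (fun i j => s.count (⟨i, j⟩ : Σ i : Fin n, Fin (ex i))) q).symm

theorem wordProd_cons (q : Σ i : Fin n, Fin (ex i)) (s : List (Σ i : Fin n, Fin (ex i))) :
    wordProd p F X (q :: s) = uemb p F L (X q.1 q.2) * wordProd p F X s := by
  simp [wordProd]

theorem wordProd_append (s t : List (Σ i : Fin n, Fin (ex i))) :
    wordProd p F X (s ++ t) = wordProd p F X s * wordProd p F X t := by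
  simp [wordProd]

variable [Fact p.Prime]

theorem wordProd_mem_omegaIdeal {s : List (Σ i : Fin n, Fin (ex i))} (hs : s ≠ []) :
    wordProd p F X s ∈ omegaIdeal p F L :=
  list_prod_mem_omegaIdeal p F (List.forall_mem_map.2 fun q _ =>
    uemb_mem_omegaIdeal p F (X q.1 q.2))
    (by simpa using hs)

theorem jIdeal_le_eSpace : jIdeal p F L ≤ eSpace p F L n ex X := le_sup_left

theorem wordProd_sortedWord_mem_eSpace {a : (i : Fin n) → Fin (ex i) → ℕ}
    (ha : ∀ i j, a i j < p) (h2 : 2 ≤ (sortedWord a).length) :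
    wordProd p F X (sortedWord a) ∈ eSpace p F L n ex X :=
  Submodule.mem_sup_right <| Submodule.subset_span
    ⟨a, ha, length_sortedWord a ▸ h2, wordProd_sortedWord p F X a⟩

/-- To check that a subspace contains `E`, it is enough to consider `J_L` and increasing words. -/
theorem eSpace_le {N : Submodule F (uEnv p F L)} (hJ : jIdeal p F L ≤ N)
    (h : ∀ a : (i : Fin n) → Fin (ex i) → ℕ, (∀ i j, a i j < p) → 2 ≤ (sortedWord a).length →
      wordProd p F X (sortedWord a) ∈ N) : eSpace p F L n ex X ≤ N := by
  refine sup_le hJ (Submodule.span_le.2 ?_)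
  rintro _ ⟨a, ha, h2, rfl⟩
  rw [← wordProd_sortedWord]
  exact h a ha (length_sortedWord a ▸ h2)

theorem eSpace_le_omegaIdeal : eSpace p F L n ex X ≤ omegaIdeal p F L :=
  eSpace_le p F X (jIdeal_le_omegaIdeal p F) fun a _ h2 =>
    wordProd_mem_omegaIdeal p F X (by rintro h; simp [h] at h2)

theorem wordProd_commutator_mem_jIdeal {s : List (Σ i : Fin n, Fin (ex i))} (hs : 2 ≤ s.length)
    (c : uEnv p F L) :
    wordProd p F X s * c - c * wordProd p F X s ∈ jIdeal p F L := by
  match s, hs with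
  | q :: q' :: s, _ =>
    rw [wordProd_cons]
    exact commutator_mul_mem_jIdeal p F (uemb_mem_omegaIdeal p F _)
      (wordProd_mem_omegaIdeal p F X (List.cons_ne_nil _ _))

/-- `E` is central modulo `J_L`. -/
theorem eSpace_commutator_mem_jIdeal {u : uEnv p F L} (hu : u ∈ eSpace p F L n ex X)
    (c : uEnv p F L) : u * c - c * u ∈ jIdeal p F L := by
  refine eSpace_le p F X (N := (jIdeal p F L).comap
    (LinearMap.mulRight F c - LinearMap.mulLeft F c)) (fun j hj => ?_) (fun a _ h2 => ?_) hu
  · exact sub_mem (jIdeal_mul_mem_right p F c j hj) (jIdeal_mul_mem_left p F c j hj)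
  · exact wordProd_commutator_mem_jIdeal p F X h2 c

theorem wordProd_mem_eSpace_of_commute {s : List (Σ i : Fin n, Fin (ex i))} (hs : 2 ≤ s.length)
    (hp : ∀ q, s.count q < p)
    (hc : ∀ q ∈ s, ∀ q' ∈ s, uemb p F L (X q.1 q.2) * uemb p F L (X q'.1 q'.2)
      - uemb p F L (X q'.1 q'.2) * uemb p F L (X q.1 q.2) ∈ jIdeal p F L) :
    wordProd p F X s ∈ eSpace p F L n ex X := by
  have hperm := perm_sortedWord_count s
  rw [← sub_add_cancel (wordProd p F X s) (wordProd p F X (sortedWord fun i j => s.count ⟨i, j⟩))]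
  refine add_mem (jIdeal_le_eSpace p F X (prod_sub_prod_mem_jIdeal_of_commute p F
    (hperm.map _) ?_)) (wordProd_sortedWord_mem_eSpace p F X (fun i j => hp _)
      (hperm.length_eq ▸ hs))
  intro a ha b hb
  obtain ⟨q, hq, rfl⟩ := List.mem_map.1 ha
  obtain ⟨q', hq', rfl⟩ := List.mem_map.1 hb
  exact hc q hq q' hq'

end Monomials

theorem flatten_replicate_perm {α : Type*} (k : ℕ) (s : List α) :
    (List.replicate k s).flatten.Perm (s.flatMap fun a => List.replicate k a) := by
  classical
  refine List.perm_iff_count.2 fun a => ?_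
  rw [List.count_flatten, List.map_replicate, List.sum_replicate]
  induction s with
  | nil => simp
  | cons b s ih =>
    rw [List.flatMap_cons, List.count_append, ← ih, List.count_replicate, List.count_cons]
    split_ifs <;> simp [mul_add, add_comm]

section Presentation

variable {p : ℕ} {F : Type*} [Field F]
variable {L : Type*} [LieRing L] [LieAlgebra F L] [RestrictedLieAlgebra p F L]
variable {n : ℕ} {e : Fin n → L} {ex : Fin n → ℕ} {X : (i : Fin n) → Fin (ex i) → L}

theorem GoodPresentation.eq_top (h : GoodPresentation p F L n e ex X) {N : Submodule F L}
    (hD : derivedP p F L ≤ N) (hX : ∀ i j, X i j ∈ N) : N = ⊤ := by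
  have htop : N.map (derivedP p F L).mkQ = ⊤ := by
    rw [eq_top_iff, ← h.2.1, Submodule.span_le]
    rintro _ ⟨q, rfl⟩
    refine ⟨_, ?_, rfl⟩
    simpa using sub_mem (hX q.1 q.2) (hD (h.2.2.2 q.1 q.2))
  have hcomap := Submodule.comap_map_mkQ (derivedP p F L) N
  rwa [htop, Submodule.comap_top, sup_eq_right.2 hD, eq_comm] at hcomap

variable [Fact p.Prime]

theorem commIdeal_le_lSub_sup_eSpace : commIdeal p F L ≤ lSub p F L ⊔ eSpace p F L n ex X := by
  refine sup_le ?_ ((jIdeal_le_eSpace p F X).trans le_sup_right)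
  rintro _ ⟨x, _, rfl⟩
  exact Submodule.mem_sup_left ⟨x, rfl⟩

/-- All words in the representatives lie in `L + E`. -/
theorem GoodPresentation.wordProd_mem (h : GoodPresentation p F L n e ex X)
    {s : List (Σ i : Fin n, Fin (ex i))} (hs : s ≠ []) :
    wordProd p F X s ∈ lSub p F L ⊔ eSpace p F L n ex X := by
  have hp := (Fact.out : p.Prime)
  induction hk : s.length using Nat.strong_induction_on generalizing s with
  | _ k ih =>
  by_cases h1 : s.length < 2
  · obtain ⟨q, rfl⟩ : ∃ q, s = [q] := List.length_eq_one_iff.1 (by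
      have := List.length_pos_iff.2 hs
      omega)
    exact Submodule.mem_sup_left ⟨X q.1 q.2, by simp [wordProd]⟩
  have hperm : ∀ {t}, s.Perm t → wordProd p F X t ∈ lSub p F L ⊔ eSpace p F L n ex X →
      wordProd p F X s ∈ lSub p F L ⊔ eSpace p F L n ex X := fun {t} ht hmem => by
    rw [← sub_add_cancel (wordProd p F X s) (wordProd p F X t)]
    exact add_mem (commIdeal_le_lSub_sup_eSpace (prod_sub_prod_mem_commIdeal p F (ht.map _))) hmem
  by_cases hcount : ∀ q, s.count q < p
  · refine hperm (perm_sortedWord_count s) (Submodule.mem_sup_right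
      (wordProd_sortedWord_mem_eSpace p F X (fun i j => hcount _) ?_))
    rw [← (perm_sortedWord_count s).length_eq]
    omega
  push Not at hcount
  obtain ⟨q, hq⟩ := hcount
  obtain ⟨r, hr⟩ := (List.replicate_sublist_iff.2 hq).exists_perm_append
  refine hperm hr ?_
  have hpow : wordProd p F X (List.replicate p q) = uemb p F L (pmap p F L (X q.1 q.2)) := by
    rw [uemb_pmap, wordProd, List.map_replicate, List.prod_replicate]
  rw [wordProd_append, hpow]
  rcases eq_or_ne r [] with rfl | hne
  · exact Submodule.mem_sup_left ⟨pmap p F L (X q.1 q.2), by simp [wordProd]⟩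
  have hN : (lSub p F L ⊔ eSpace p F L n ex X).comap
      (LinearMap.mulRight F (wordProd p F X r) ∘ₗ uemb p F L) = ⊤ := by
    refine h.eq_top (fun l hl => ?_) (fun i j => ?_)
    · exact Submodule.mem_sup_right (jIdeal_le_eSpace p F X (commIdeal_mul_omega_mem p F
        (uemb_mem_commIdeal p F hl) (wordProd_mem_omegaIdeal p F X hne)))
    · have hlen := hr.length_eq
      rw [List.length_append, List.length_replicate] at hlen
      have := hp.two_le
      have hw := ih (r.length + 1) (by omega) (s := ⟨i, j⟩ :: r) (List.cons_ne_nil _ _) rfl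
      rwa [wordProd_cons] at hw
  exact hN.ge (Submodule.mem_top (x := pmap p F L (X q.1 q.2)))

/-- `ω(L) = L + E`, one inclusion. -/
theorem GoodPresentation.omegaIdeal_le (h : GoodPresentation p F L n e ex X) :
    omegaIdeal p F L ≤ lSub p F L ⊔ eSpace p F L n ex X := by
  let N := Submodule.span F (Set.range (wordProd p F X)) ⊔ commIdeal p F L
  have hmul : ∀ a : uEnv p F L, ∀ b ∈ N, a * b ∈ N := by
    intro a
    induction a using uEnv_induction with
    | hx x =>
      intro b hb
      have hle : N ≤ N.comap (LinearMap.mulLeft F (uemb p F L x)) := by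
        refine sup_le (Submodule.span_le.2 ?_) fun k hk =>
          Submodule.mem_sup_right (commIdeal_mul_mem_left p F _ hk)
        rintro _ ⟨s, rfl⟩
        have hN : N.comap (LinearMap.mulRight F (wordProd p F X s) ∘ₗ uemb p F L) = ⊤ := by
          refine h.eq_top (fun l hl => ?_) (fun i j => ?_)
          · exact Submodule.mem_sup_right
              (commIdeal_mul_mem_right p F _ (uemb_mem_commIdeal p F hl))
          · exact Submodule.mem_sup_left
              (Submodule.subset_span ⟨⟨i, j⟩ :: s, wordProd_cons p F X _ _⟩)
        exact hN.ge (Submodule.mem_top (x := x))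
      exact hle hb
    | hc c => exact fun b hb => by rw [← Algebra.smul_def]; exact N.smul_mem c hb
    | hadd a a' ha ha' => exact fun b hb => by rw [add_mul]; exact add_mem (ha b hb) (ha' b hb)
    | hmul a a' ha ha' => exact fun b hb => by rw [mul_assoc]; exact ha _ (ha' b hb)
  have h1 : (1 : uEnv p F L) ∈ N :=
    Submodule.mem_sup_left (Submodule.subset_span ⟨[], by simp [wordProd]⟩)
  have hle : N ≤ Submodule.span F {1} ⊔ (lSub p F L ⊔ eSpace p F L n ex X) := by
    refine sup_le (Submodule.span_le.2 ?_) (commIdeal_le_lSub_sup_eSpace.trans le_sup_right)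
    rintro _ ⟨s, rfl⟩
    rcases eq_or_ne s [] with rfl | hs
    · exact Submodule.mem_sup_left (Submodule.mem_span_singleton.2 ⟨1, by simp [wordProd]⟩)
    · exact Submodule.mem_sup_right (h.wordProd_mem hs)
  have hω : lSub p F L ⊔ eSpace p F L n ex X ≤ omegaIdeal p F L :=
    sup_le (by rintro _ ⟨x, rfl⟩; exact uemb_mem_omegaIdeal p F x) (eSpace_le_omegaIdeal p F X)
  intro w hw
  obtain ⟨_, hc, v, hv, rfl⟩ := Submodule.mem_sup.1 (hle (by simpa using hmul w 1 h1))
  obtain ⟨c, rfl⟩ := Submodule.mem_span_singleton.1 hc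
  have hc0 : c = 0 := by
    rw [mem_omegaIdeal, map_add, (mem_omegaIdeal p F).1 (hω hv)] at hw
    simpa using hw
  simpa [hc0] using hv

/-- The index of the next `p`-power. -/
def nextIndex (q : Σ i : Fin n, Fin (ex i)) : Σ i : Fin n, Fin (ex i) :=
  if h : (q.2 : ℕ) + 1 < ex q.1 then ⟨q.1, ⟨q.2 + 1, h⟩⟩ else q

theorem nextIndex_injOn {q q' : Σ i : Fin n, Fin (ex i)} (hq : (q.2 : ℕ) + 1 < ex q.1)
    (hq' : (q'.2 : ℕ) + 1 < ex q'.1) (h : nextIndex q = nextIndex q') : q = q' := by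
  obtain ⟨i, j⟩ := q
  obtain ⟨i', j'⟩ := q'
  simp only [nextIndex, dif_pos hq, dif_pos hq'] at h
  obtain ⟨rfl, h⟩ := Sigma.mk.inj_iff.1 h
  simp only [heq_eq_eq, Fin.mk.injEq, add_left_inj] at h
  rw [Fin.ext h]

theorem GoodPresentation.pow_sub_mem_commIdeal (h : GoodPresentation p F L n e ex X)
    (q : Σ i : Fin n, Fin (ex i)) :
    uemb p F L (X q.1 q.2) ^ p - uemb p F L ((pmap p F L)^[(q.2 : ℕ) + 1] (e q.1))
      ∈ commIdeal p F L := by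
  rw [Function.iterate_succ_apply', uemb_pmap]
  refine pow_sub_pow_mem_commIdeal p F ?_ p
  rw [← map_sub]
  exact uemb_mem_commIdeal p F (h.2.2.2 q.1 q.2)

theorem GoodPresentation.pow_sub_nextIndex_mem (h : GoodPresentation p F L n e ex X)
    {q : Σ i : Fin n, Fin (ex i)} (hq : (q.2 : ℕ) + 1 < ex q.1) :
    uemb p F L (X q.1 q.2) ^ p - uemb p F L (X (nextIndex q).1 (nextIndex q).2)
      ∈ commIdeal p F L := by
  have h1 := sub_mem (h.pow_sub_mem_commIdeal q)
    (uemb_mem_commIdeal p F (h.2.2.2 q.1 ⟨q.2 + 1, hq⟩))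
  rw [map_sub] at h1
  rw [nextIndex, dif_pos hq]
  simpa using h1

theorem GoodPresentation.pow_mem_commIdeal (h : GoodPresentation p F L n e ex X)
    {q : Σ i : Fin n, Fin (ex i)} (hq : ¬ (q.2 : ℕ) + 1 < ex q.1) :
    uemb p F L (X q.1 q.2) ^ p ∈ commIdeal p F L := by
  have h1 := h.pow_sub_mem_commIdeal q
  have h2 : (q.2 : ℕ) + 1 = ex q.1 := by have := q.2.isLt; omega
  rw [h2] at h1
  simpa using add_mem h1 (uemb_mem_commIdeal p F (h.2.2.1 q.1))

theorem GoodPresentation.nextIndex_commutator_mem (h : GoodPresentation p F L n e ex X)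
    {q : Σ i : Fin n, Fin (ex i)} (hq : (q.2 : ℕ) + 1 < ex q.1) {w : uEnv p F L}
    (hw : w ∈ omegaIdeal p F L) :
    uemb p F L (X (nextIndex q).1 (nextIndex q).2) * w
      - w * uemb p F L (X (nextIndex q).1 (nextIndex q).2) ∈ jIdeal p F L := by
  have hk := h.pow_sub_nextIndex_mem hq
  set x := uemb p F L (X q.1 q.2)
  set y := uemb p F L (X (nextIndex q).1 (nextIndex q).2)
  have hx : x ∈ omegaIdeal p F L := uemb_mem_omegaIdeal p F _
  obtain ⟨k, hpk⟩ := Nat.exists_eq_add_of_le' (Fact.out : p.Prime).two_le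
  have h1 : x ^ p * w - w * x ^ p ∈ jIdeal p F L := by
    rw [show x ^ p = x * x ^ (k + 1) from (congrArg (x ^ ·) hpk).trans (pow_succ' x (k + 1))]
    exact commutator_mul_mem_jIdeal p F hx
      (by rw [pow_succ]; exact mul_mem_omegaIdeal_left p F _ hx)
  rw [show y * w - w * y = (x ^ p * w - w * x ^ p) - ((x ^ p - y) * w - w * (x ^ p - y)) by
    noncomm_ring]
  exact sub_mem h1 (sub_mem (commIdeal_mul_omega_mem p F hk hw) (omega_mul_commIdeal_mem p F hk hw))

theorem GoodPresentation.wordProd_pow_mem_eSpace (h : GoodPresentation p F L n e ex X)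
    {s : List (Σ i : Fin n, Fin (ex i))} (hs : 2 ≤ s.length) (hcount : ∀ q, s.count q < p) :
    wordProd p F X s ^ p ∈ eSpace p F L n ex X := by
  have hp := (Fact.out : p.Prime)
  let f : (Σ i : Fin n, Fin (ex i)) → uEnv p F L := fun q => uemb p F L (X q.1 q.2)
  have hf : ∀ q, f q ∈ omegaIdeal p F L := fun q => uemb_mem_omegaIdeal p F _
  let g : (Σ i : Fin n, Fin (ex i)) → uEnv p F L := fun q =>
    if (q.2 : ℕ) + 1 < ex q.1 then f (nextIndex q) else 0
  have hreorder : wordProd p F X s ^ p - (s.map fun q => f q ^ p).prod ∈ jIdeal p F L := by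
    have hperm : ((List.replicate p s).flatten).Perm (s.flatMap fun q => List.replicate p q) :=
      flatten_replicate_perm p s
    have h1 := prod_sub_prod_mem_jIdeal p F (hperm.map f)
      (by intro a ha; obtain ⟨q, -, rfl⟩ := List.mem_map.1 ha; exact hf q)
      (by simp; nlinarith [hp.two_le])
    have h2 : ((s.flatMap fun q => List.replicate p q).map f).prod
        = (s.map fun q => f q ^ p).prod := by
      simp only [List.flatMap, List.map_flatten, List.prod_flatten, List.map_map,
        Function.comp_def, List.map_replicate, List.prod_replicate]
    rw [h2] at h1
    simpa [List.map_flatten, List.prod_flatten, wordProd, f] using h1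
  have hshift : (s.map fun q => f q ^ p).prod - (s.map g).prod ∈ jIdeal p F L := by
    refine prod_map_sub_prod_map_mem_jIdeal p F (fun q => ?_) (fun q => ?_) (fun q => ?_) hs
    · rw [← uemb_pmap]
      exact uemb_mem_omegaIdeal p F _
    · simp only [g]
      split_ifs
      · exact hf _
      · exact zero_mem _
    · simp only [g]
      split_ifs with hq
      · exact h.pow_sub_nextIndex_mem hq
      · rw [sub_zero]
        exact h.pow_mem_commIdeal hq
  have hg : (s.map g).prod ∈ eSpace p F L n ex X := by
    by_cases hall : ∀ q ∈ s, (q.2 : ℕ) + 1 < ex q.1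
    · have hmap : (s.map g).prod = wordProd p F X (s.map nextIndex) := by
        rw [wordProd, List.map_map]
        exact congrArg _ (List.map_congr_left fun q hq => if_pos (hall q hq))
      rw [hmap]
      refine wordProd_mem_eSpace_of_commute p F X (by simpa using hs) (fun q' => ?_) ?_
      · by_cases hmem : q' ∈ s.map nextIndex
        · obtain ⟨q, hq, rfl⟩ := List.mem_map.1 hmem
          refine lt_of_le_of_lt ?_ (hcount q)
          rw [List.count, List.count, List.countP_map]
          refine List.countP_mono_left fun x hx hxq => ?_
          simp only [Function.comp_apply, beq_iff_eq] at hxq ⊢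
          exact nextIndex_injOn (hall x hx) (hall q hq) hxq
        · rw [List.count_eq_zero_of_not_mem hmem]
          exact hp.pos
      · intro q₁ hq₁ q' _
        obtain ⟨q, hq, rfl⟩ := List.mem_map.1 hq₁
        exact h.nextIndex_commutator_mem (hall q hq) (hf q')
    · push Not at hall
      obtain ⟨q, hq, hlt⟩ := hall
      rw [List.prod_eq_zero (List.mem_map.2 ⟨q, hq, if_neg hlt.not_gt⟩)]
      exact zero_mem _
  have := add_mem (jIdeal_le_eSpace p F X (add_mem hreorder hshift)) hg
  simpa using this

/-- `E` is closed under `p`-th powers. -/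
theorem GoodPresentation.pow_mem_eSpace [CharP F p] (h : GoodPresentation p F L n e ex X)
    {u : uEnv p F L} (hu : u ∈ eSpace p F L n ex X) : u ^ p ∈ eSpace p F L n ex X := by
  have hp := (Fact.out : p.Prime)
  have hadd : ∀ a ∈ eSpace p F L n ex X, ∀ b, a ^ p ∈ eSpace p F L n ex X →
      b ^ p ∈ eSpace p F L n ex X → (a + b) ^ p ∈ eSpace p F L n ex X := by
    intro a ha b hap hbp
    have := add_mem (jIdeal_le_eSpace p F X (add_pow_sub_mem_jIdeal p F
      (eSpace_commutator_mem_jIdeal p F X ha b))) (add_mem hap hbp)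
    rwa [sub_sub, sub_add_cancel] at this
  let N : Submodule F (uEnv p F L) :=
    { carrier := {a | a ∈ eSpace p F L n ex X ∧ a ^ p ∈ eSpace p F L n ex X}
      zero_mem' := ⟨zero_mem _, by rw [zero_pow hp.ne_zero]; exact zero_mem _⟩
      add_mem' := fun {a b} ha hb => ⟨add_mem ha.1 hb.1, hadd a ha.1 b ha.2 hb.2⟩
      smul_mem' := fun c a ha => ⟨Submodule.smul_mem _ c ha.1, by
        rw [smul_pow]; exact Submodule.smul_mem _ _ ha.2⟩ }
  have hle : eSpace p F L n ex X ≤ N := by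
    refine eSpace_le p F X (fun j hj => ⟨jIdeal_le_eSpace p F X hj,
      jIdeal_le_eSpace p F X (pow_mem_jIdeal_of_mem_jIdeal p F hj)⟩) fun a ha h2 => ?_
    exact ⟨wordProd_sortedWord_mem_eSpace p F X ha h2,
      h.wordProd_pow_mem_eSpace h2 fun q => by rw [count_sortedWord]; exact ha _ _⟩
  exact (hle hu).2

end Presentation

section TruncatedPolynomials

open MvPolynomial

theorem exists_truncated_mvPolynomial_algebra.{u} (F : Type u) [Field F] {n : ℕ} (N : Fin n → ℕ) :
    ∃ (B : Type u) (_ : CommRing B) (_ : Algebra F B) (x : Fin n → B),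
      (∀ i, x i ^ N i = 0) ∧
      ∀ {α : Type} (d : α → Fin n → ℕ), Function.Injective d → (∀ a i, d a i < N i) →
        LinearIndependent F fun a => ∏ i, x i ^ d a i := by
  let I : Ideal (MvPolynomial (Fin n) F) :=
    Ideal.span ((fun d => monomial d 1) '' Set.range fun i => Finsupp.single i (N i))
  refine ⟨MvPolynomial (Fin n) F ⧸ I, inferInstance, inferInstance,
    fun i => Ideal.Quotient.mk I (X i), fun i => ?_, fun {α} d hd hN => ?_⟩
  · rw [← map_pow, X_pow_eq_monomial]
    exact Ideal.Quotient.eq_zero_iff_mem.2 (Ideal.subset_span ⟨_, ⟨i, rfl⟩, rfl⟩)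
  · let δ : α → Fin n →₀ ℕ := fun a => Finsupp.equivFunOnFinite.symm (d a)
    have hδ : ∀ a, ∏ i, Ideal.Quotient.mk I (X i) ^ d a i
        = Ideal.Quotient.mkₐ F I (monomial (δ a) 1) := fun a => by
      rw [monomial_eq, Finsupp.prod_fintype _ _ (by simp)]
      simp [δ]
    simp only [hδ]
    have hδinj : Function.Injective δ := Finsupp.equivFunOnFinite.symm.injective.comp hd
    refine linearIndependent_iff'.2 fun s c hc a ha => ?_
    by_contra hca
    have hmem : ∑ b ∈ s, c b • monomial (δ b) (1 : F) ∈ I := by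
      rw [← Ideal.Quotient.eq_zero_iff_mem, ← Ideal.Quotient.mkₐ_eq_mk F, map_sum]
      simpa only [map_smul] using hc
    have hcoeff : coeff (δ a) (∑ b ∈ s, c b • monomial (δ b) (1 : F)) = c a := by
      rw [coeff_sum, Finset.sum_eq_single a]
      · simp
      · intro b _ hb
        simp [coeff_monomial, hδinj.ne hb]
      · exact fun h => absurd ha h
    obtain ⟨_, ⟨i, rfl⟩, hle⟩ := mem_ideal_span_monomial_image.1 hmem (δ a)
      (mem_support_iff.2 (by rwa [hcoeff]))
    have := hle i
    simp only [Finsupp.single_eq_same, δ, Finsupp.equivFunOnFinite_symm_apply_apply] at this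
    exact (hN a i).not_ge this

end TruncatedPolynomials

theorem sum_digits_lt {p k : ℕ} (a : Fin k → ℕ) (ha : ∀ j, a j < p) :
    ∑ j, a j * p ^ (j : ℕ) < p ^ k := by
  have h := (finFunctionFinEquiv fun j => (⟨a j, ha j⟩ : Fin p)).isLt
  rwa [finFunctionFinEquiv_apply] at h

theorem eq_of_sum_digits_eq {p k : ℕ} {a b : Fin k → ℕ} (ha : ∀ j, a j < p) (hb : ∀ j, b j < p)
    (h : ∑ j, a j * p ^ (j : ℕ) = ∑ j, b j * p ^ (j : ℕ)) : a = b := by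
  have h' : finFunctionFinEquiv (fun j => (⟨a j, ha j⟩ : Fin p))
      = finFunctionFinEquiv fun j => (⟨b j, hb j⟩ : Fin p) := by
    ext
    rwa [finFunctionFinEquiv_apply, finFunctionFinEquiv_apply]
  funext j
  exact congrArg Fin.val (congrFun (finFunctionFinEquiv.injective h') j)

section Independence

variable {p : ℕ} {F : Type*} [Field F] [Fact p.Prime]
variable {L : Type*} [LieRing L] [LieAlgebra F L] [RestrictedLieAlgebra p F L]
variable {n : ℕ} {e : Fin n → L} {ex : Fin n → ℕ} {X : (i : Fin n) → Fin (ex i) → L}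

theorem GoodPresentation.exists_commutative_quotient
    (h : GoodPresentation p F L n e ex X) {B : Type*} [CommRing B] [Algebra F B] (x : Fin n → B)
    (hx : ∀ i, x i ^ p ^ ex i = 0) :
    ∃ g : uEnv p F L →ₐ[F] B, (∀ i j, g (uemb p F L (X i j)) = x i ^ p ^ (j : ℕ)) ∧
      ∀ k ∈ commIdeal p F L, g k = 0 := by
  have hp := (Fact.out : p.Prime)
  let b := Module.Basis.mk h.1 h.2.1.ge
  let f : L →ₗ[F] B := b.constr F (fun q => x q.1 ^ p ^ (q.2 : ℕ)) ∘ₗ (derivedP p F L).mkQ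
  have hfD : ∀ l ∈ derivedP p F L, f l = 0 := fun l hl => by
    rw [LinearMap.comp_apply, Submodule.mkQ_apply, (Submodule.Quotient.mk_eq_zero _).2 hl, map_zero]
  have hfe : ∀ i (j : Fin (ex i)), f ((pmap p F L)^[(j : ℕ)] (e i)) = x i ^ p ^ (j : ℕ) := by
    intro i j
    have hb : (derivedP p F L).mkQ ((pmap p F L)^[(j : ℕ)] (e i)) = b ⟨i, j⟩ := by
      simp [b]
    rw [LinearMap.comp_apply, hb, Module.Basis.constr_basis]
  have hfX : ∀ i j, f (X i j) = x i ^ p ^ (j : ℕ) := fun i j => by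
    rw [← hfe, ← sub_eq_zero, ← map_sub]
    exact hfD _ (h.2.2.2 i j)
  have hflie : ∀ y z : L, f ⁅y, z⁆ = f y * f z - f z * f y := fun y z => by
    rw [hfD _ (derivedSub_le_derivedP p F (lie_mem_derivedSub F y z)), mul_comm, sub_self]
  let N : Submodule F L :=
    { carrier := {y | f (pmap p F L y) = f y ^ p}
      zero_mem' := by simp [pmap_zero, hp.ne_zero]
      add_mem' := fun {y z} hy hz => by
        have := map_pmap_add p F L f hflie y z
        simp only [Set.mem_ofPred_eq] at hy hz ⊢
        rw [hy, hz, sub_left_inj, sub_left_inj] at this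
        rw [this, map_add]
      smul_mem' := fun c y hy => by
        simp only [Set.mem_ofPred_eq] at hy ⊢
        rw [pmap, RestrictedLieAlgebra.pOp_smul, map_smul, map_smul, smul_pow, hy] }
  have hND : derivedP p F L ≤ N := fun l hl => by
    change f (pmap p F L l) = f l ^ p
    rw [hfD _ (pmap_mem_derivedP p F hl), hfD l hl, zero_pow hp.ne_zero]
  have hN : N = ⊤ := by
    refine h.eq_top hND fun i j => ?_
    rw [← sub_add_cancel (X i j) ((pmap p F L)^[(j : ℕ)] (e i))]
    refine add_mem (hND (h.2.2.2 i j)) ?_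
    change f (pmap p F L _) = f _ ^ p
    rw [hfe, ← Function.iterate_succ_apply' (pmap p F L), ← pow_mul, ← pow_succ]
    by_cases hj : (j : ℕ) + 1 < ex i
    · exact hfe i ⟨j + 1, hj⟩
    · have hj' : (j : ℕ) + 1 = ex i := by have := j.isLt; omega
      rw [Nat.succ_eq_add_one, hj', hx, hfD _ (h.2.2.1 i)]
  obtain ⟨g, hg⟩ := exists_uEnv_lift p F L f hflie fun y => hN.ge (Submodule.mem_top (x := y))
  have hgD : ∀ l ∈ derivedSub F L, g (uemb p F L l) = 0 := fun l hl => by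
    rw [hg, hfD l (derivedSub_le_derivedP p F hl)]
  refine ⟨g, fun i j => by rw [hg, hfX], fun k hk => ?_⟩
  have hle : commIdeal p F L ≤ LinearMap.ker g.toLinearMap := by
    refine sup_le ?_ (jIdeal_le p F (fun w _ l hl => ?_) fun w _ l hl => ?_)
    · rintro _ ⟨l, hl, rfl⟩
      exact hgD l hl
    · simp [hgD l hl]
    · simp [hgD l hl]
  exact hle hk

/-- `L ∩ E ⊆ J_L`. -/
theorem GoodPresentation.uemb_mem_jIdeal (h : GoodPresentation p F L n e ex X) {x : L}
    (hx : uemb p F L x ∈ eSpace p F L n ex X) : uemb p F L x ∈ jIdeal p F L := by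
  have hp := (Fact.out : p.Prime)
  obtain ⟨B, _, _, t, ht, hli⟩ :=
    exists_truncated_mvPolynomial_algebra F fun i => p ^ ex i
  obtain ⟨g, hg, hgK⟩ := h.exists_commutative_quotient t ht
  let m : {a : (i : Fin n) → Fin (ex i) → ℕ // ∀ i j, a i j < p} → uEnv p F L :=
    fun a => wordProd p F X (sortedWord a.1)
  have hgm : ∀ a, g (m a) = ∏ i, t i ^ ∑ j, a.1 i j * p ^ (j : ℕ) := fun a => by
    simp only [m, wordProd_sortedWord, map_list_prod, List.map_map, Function.comp_def, map_pow, hg,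
      ← Fin.prod_univ_def]
    refine Finset.prod_congr rfl fun i _ => ?_
    rw [← Finset.prod_pow_eq_pow_sum]
    exact Finset.prod_congr rfl fun j _ => by rw [← pow_mul, mul_comm]
  have hind : LinearIndependent F (g.toLinearMap ∘ m) := by
    have := hli (α := {a : (i : Fin n) → Fin (ex i) → ℕ // ∀ i j, a i j < p})
      (fun a i => ∑ j, a.1 i j * p ^ (j : ℕ))
      (fun a b hab => Subtype.ext (funext fun i =>
        eq_of_sum_digits_eq (a.2 i) (b.2 i) (congrFun hab i)))
      (fun a i => sum_digits_lt _ (a.2 i))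
    convert this using 2 with a
    exact hgm a
  let S₁ : Set {a : (i : Fin n) → Fin (ex i) → ℕ // ∀ i j, a i j < p} :=
    {a | (sortedWord a.1).length = 1}
  let S₂ : Set {a : (i : Fin n) → Fin (ex i) → ℕ // ∀ i j, a i j < p} :=
    {a | 2 ≤ (sortedWord a.1).length}
  have hS : Disjoint S₁ S₂ := Set.disjoint_left.2 fun a h1 h2 => by
    simp only [S₁, S₂, Set.mem_ofPred_eq] at h1 h2
    omega
  have hL : (Submodule.span F (m '' S₁) ⊔ commIdeal p F L).comap (uemb p F L) = ⊤ := by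
    refine h.eq_top (fun l hl => Submodule.mem_sup_right (uemb_mem_commIdeal p F hl))
      fun i j => Submodule.mem_sup_left (Submodule.subset_span ?_)
    have hs := List.perm_singleton.1
      (perm_sortedWord_count [(⟨i, j⟩ : Σ i : Fin n, Fin (ex i))]).symm
    refine ⟨⟨fun i' j' => [(⟨i, j⟩ : Σ i : Fin n, Fin (ex i))].count ⟨i', j'⟩, fun i' j' =>
      lt_of_le_of_lt List.count_le_length hp.one_lt⟩, ?_, ?_⟩
    · simp only [S₁, Set.mem_ofPred_eq, hs, List.length_singleton]
    · simp only [m, hs]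
      simp [wordProd]
  have hE : eSpace p F L n ex X ≤ jIdeal p F L ⊔ Submodule.span F (m '' S₂) :=
    eSpace_le p F X le_sup_left fun a ha h2 =>
      Submodule.mem_sup_right (Submodule.subset_span ⟨⟨a, ha⟩, h2, rfl⟩)
  obtain ⟨v₁, hv₁, k, hk, hxk⟩ := Submodule.mem_sup.1 (hL.ge (Submodule.mem_top (x := x)))
  obtain ⟨j, hj, v₂, hv₂, hxj⟩ := Submodule.mem_sup.1 (hE hx)
  have hgv : g v₁ = g v₂ := by
    have := congrArg g (hxk.trans hxj.symm)
    rwa [map_add, map_add, hgK k hk, hgK j (jIdeal_le_commIdeal p F hj), add_zero,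
      zero_add] at this
  have himage : ∀ S, ∀ v ∈ Submodule.span F (m '' S),
      g v ∈ Submodule.span F ((g.toLinearMap ∘ m) '' S) := fun S v hv => by
    rw [Set.image_comp, ← Submodule.map_span]
    exact Submodule.mem_map_of_mem (f := g.toLinearMap) hv
  have hg0 : g v₂ = 0 := Submodule.disjoint_def.1 (hind.disjoint_span_image hS) _
    (hgv ▸ himage S₁ v₁ hv₁) (himage S₂ v₂ hv₂)
  have hv0 : v₂ = 0 := Submodule.disjoint_def.1 (Submodule.range_ker_disjoint hind) _
    (Submodule.span_mono (Set.image_subset_range _ _) hv₂) hg0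
  rwa [← hxj, hv0, add_zero]

end Independence

end RestrictedLieAlgebra

open RestrictedLieAlgebra in
/-- With the running setup (`E ⊆ u(L)` and the decomposition
`ω(H)/J_H = (H + J_H)/J_H ⊕ φ(E)/J_H`), the isomorphism `ω(L)/J_L → ω(H)/J_H` induced
by `φ`, restricted to `(L + J_L)/J_L ≅ L/(L'^p + γ₃(L))` and followed by the projection
onto `(H + J_H)/J_H ≅ H/(H'^p + γ₃(H))` along `φ(E)/J_H`, is an isomorphism of
restricted Lie algebras; consequently
`L/(L'^p + γ₃(L)) ≅ H/(H'^p + γ₃(H))` as restricted Lie algebras. -/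
theorem induced_restricted_iso
    (p : ℕ) (F L H : Type*) [Field F] [Fact p.Prime] [CharP F p] [PerfectField F]
    [LieRing L] [LieAlgebra F L] [RestrictedLieAlgebra p F L]
    [LieRing H] [LieAlgebra F H] [RestrictedLieAlgebra p F H]
    [FiniteDimensional F L] [FiniteDimensional F H]
    (hL : IsPNilpotent p F L) (hH : IsPNilpotent p F H)
    (n : ℕ) (e : Fin n → L) (ex : Fin n → ℕ) (X : (i : Fin n) → Fin (ex i) → L)
    (hpres : GoodPresentation p F L n e ex X)
    (φ : uEnv p F L ≃ₐ[F] uEnv p F H)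
    (hω : (omegaIdeal p F L).map φ.toLinearMap = omegaIdeal p F H)
    (hdec : Disjoint ((lSub p F H ⊔ jIdeal p F H).map (jIdeal p F H).mkQ)
          (((eSpace p F L n ex X).map φ.toLinearMap).map (jIdeal p F H).mkQ) ∧
        ((lSub p F H ⊔ jIdeal p F H).map (jIdeal p F H).mkQ ⊔
            ((eSpace p F L n ex X).map φ.toLinearMap).map (jIdeal p F H).mkQ)
          = (omegaIdeal p F H).map (jIdeal p F H).mkQ) :
    ∃ ψ : (L ⧸ mainIdeal p F L) ≃ₗ[F] (H ⧸ mainIdeal p F H),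
      -- `ψ` is induced by `φ` followed by the projection along `φ(E)/J_H`:
      (∀ (x : L) (y : H),
          φ (uemb p F L x) - uemb p F H y
              ∈ (eSpace p F L n ex X).map φ.toLinearMap ⊔ jIdeal p F H →
          ψ (Submodule.Quotient.mk x) = Submodule.Quotient.mk y) ∧
      -- `ψ` is an isomorphism of restricted Lie algebras:
      (∀ (x x' : L) (y y' : H),
        ψ (Submodule.Quotient.mk x) = Submodule.Quotient.mk y →
        ψ (Submodule.Quotient.mk x') = Submodule.Quotient.mk y' →
        ψ (Submodule.Quotient.mk ⁅x, x'⁆) = Submodule.Quotient.mk ⁅y, y'⁆ ∧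
        ψ (Submodule.Quotient.mk (pmap p F L x))
          = Submodule.Quotient.mk (pmap p F H y)) := by
  have hφω : ∀ a ∈ omegaIdeal p F L, φ a ∈ omegaIdeal p F H := fun a ha =>
    hω ▸ Submodule.mem_map_of_mem (f := φ.toLinearMap) ha
  have hφω' : ∀ b ∈ omegaIdeal p F H, φ.symm b ∈ omegaIdeal p F L := fun b hb => by
    rw [← hω] at hb
    obtain ⟨a, ha, rfl⟩ := hb
    simpa using ha
  have hφJ : ∀ a ∈ jIdeal p F L, φ a ∈ jIdeal p F H := fun a ha =>
    map_jIdeal_le p F φ.toAlgHom hφω ha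
  set E := (eSpace p F L n ex X).map φ.toLinearMap
  have hEmem : ∀ u ∈ eSpace p F L n ex X, φ u ∈ E := fun u hu =>
    Submodule.mem_map_of_mem (f := φ.toLinearMap) hu
  have hEmem' : ∀ u, φ u ∈ E → u ∈ eSpace p F L n ex X := fun u ⟨v, hv, hvu⟩ =>
    φ.injective hvu ▸ hv
  have hJE : jIdeal p F H ≤ E := fun b hb => by
    rw [← φ.apply_symm_apply b]
    exact hEmem _ (jIdeal_le_eSpace p F X (map_jIdeal_le p F φ.symm.toAlgHom hφω' hb))
  rw [sup_eq_left.2 hJE]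
  have hcentral : ∀ u ∈ E, ∀ b, u * b - b * u ∈ jIdeal p F H := by
    rintro _ ⟨u, hu, rfl⟩ b
    have := hφJ _ (eSpace_commutator_mem_jIdeal p F X hu (φ.symm b))
    simpa using this
  have hEpow : ∀ u ∈ E, u ^ p ∈ E := by
    rintro _ ⟨u, hu, rfl⟩
    have := hEmem _ (hpres.pow_mem_eSpace hu)
    simpa using this
  have hexists : ∀ x, ∃ y, φ (uemb p F L x) - uemb p F H y ∈ E := fun x => by
    have hmem : (jIdeal p F H).mkQ (φ (uemb p F L x))
        ∈ (omegaIdeal p F H).map (jIdeal p F H).mkQ :=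
      Submodule.mem_map_of_mem (hφω _ (uemb_mem_omegaIdeal p F x))
    rw [← hdec.2] at hmem
    obtain ⟨_, ⟨a, ha, rfl⟩, _, ⟨b, hb, rfl⟩, hab⟩ := Submodule.mem_sup.1 hmem
    obtain ⟨_, ⟨y, rfl⟩, j, hj, rfl⟩ := Submodule.mem_sup.1 ha
    refine ⟨y, ?_⟩
    rw [← map_add, eq_comm, ← sub_eq_zero, ← map_sub, Submodule.mkQ_apply,
      Submodule.Quotient.mk_eq_zero] at hab
    have := add_mem (hJE hab) (add_mem (hJE hj) hb)
    convert this using 1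
    abel
  have hunique : ∀ y, uemb p F H y ∈ E → y ∈ mainIdeal p F H := fun y hy => by
    refine mem_mainIdeal_of_uemb_mem_jIdeal p hH ((Submodule.Quotient.mk_eq_zero _).1 ?_)
    exact Submodule.disjoint_def.1 hdec.1 _
      (Submodule.mem_map_of_mem (f := (jIdeal p F H).mkQ) (Submodule.mem_sup_left ⟨y, rfl⟩))
      (Submodule.mem_map_of_mem (f := (jIdeal p F H).mkQ) hy)
  choose s hs using hexists
  have hmk : ∀ x y, φ (uemb p F L x) - uemb p F H y ∈ E →
      (Submodule.Quotient.mk (s x) : H ⧸ mainIdeal p F H) = Submodule.Quotient.mk y := by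
    refine fun x y hxy => (Submodule.Quotient.eq _).2 (hunique _ ?_)
    have := sub_mem hxy (hs x)
    rwa [sub_sub_sub_cancel_left, ← map_sub] at this
  let ψ₀ : L →ₗ[F] H ⧸ mainIdeal p F H :=
    { toFun := fun x => Submodule.Quotient.mk (s x)
      map_add' := fun x x' => by
        rw [← Submodule.Quotient.mk_add]
        refine hmk _ _ ?_
        have := add_mem (hs x) (hs x')
        rwa [← add_sub_add_comm, ← map_add, ← map_add, ← map_add] at this
      map_smul' := fun c x => by
        rw [RingHom.id_apply, ← Submodule.Quotient.mk_smul]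
        refine hmk _ _ ?_
        have := E.smul_mem c (hs x)
        rwa [smul_sub, ← map_smul, ← map_smul, ← map_smul] at this }
  have hrel : ∀ x y, ψ₀ x = Submodule.Quotient.mk y →
      φ (uemb p F L x) - uemb p F H y ∈ E := fun x y hxy => by
    have := add_mem (hs x) (hJE (uemb_mem_jIdeal_of_mem_mainIdeal p F
      ((Submodule.Quotient.eq _).1 hxy)))
    rwa [map_sub, sub_add_sub_cancel] at this
  have hker : mainIdeal p F L = LinearMap.ker ψ₀ := by
    ext x
    rw [LinearMap.mem_ker]
    refine ⟨fun hx => hmk x 0 ?_, fun hx => mem_mainIdeal_of_uemb_mem_jIdeal p hL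
      (hpres.uemb_mem_jIdeal (hEmem' _ ?_))⟩
    · rw [map_zero, sub_zero]
      exact hJE (hφJ _ (uemb_mem_jIdeal_of_mem_mainIdeal p F hx))
    · simpa using hrel x 0 hx
  have hsurj : Function.Surjective ψ₀ := fun z => by
    obtain ⟨y, rfl⟩ := Submodule.Quotient.mk_surjective _ z
    obtain ⟨_, ⟨x, rfl⟩, u, hu, hxu⟩ := Submodule.mem_sup.1
      (hpres.omegaIdeal_le (hφω' _ (uemb_mem_omegaIdeal p F y)))
    refine ⟨x, hmk x y ?_⟩
    rw [← φ.apply_symm_apply (uemb p F H y), ← hxu, map_add, sub_add_cancel_left]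
    exact neg_mem (hEmem u hu)
  let ψ : (L ⧸ mainIdeal p F L) ≃ₗ[F] (H ⧸ mainIdeal p F H) :=
    (Submodule.quotEquivOfEq _ _ hker).trans (ψ₀.quotKerEquivOfSurjective hsurj)
  refine ⟨ψ, fun x y hxy => hmk x y hxy, fun x x' y y' hx hx' => 
    ⟨hmk ⁅x, x'⁆ ⁅y, y'⁆ ?_, hmk (pmap p F L x) (pmap p F H y) ?_⟩⟩
  · have hu := hrel x y hx
    have hu' := hrel x' y' hx'
    rw [uemb_lie, uemb_lie, map_sub, map_mul, map_mul]
    set a := φ (uemb p F L x)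
    set a' := φ (uemb p F L x')
    set b := uemb p F H y
    set b' := uemb p F H y'
    rw [show a * a' - a' * a - (b * b' - b' * b)
      = ((a - b) * a' - a' * (a - b)) - ((a' - b') * b - b * (a' - b')) by noncomm_ring]
    exact hJE (sub_mem (hcentral _ hu _) (hcentral _ hu' _))
  · have hu := hrel x y hx
    rw [uemb_pmap, uemb_pmap, map_pow]
    have h1 := add_pow_sub_mem_jIdeal p F (hcentral _ hu (uemb p F H y))
    rw [sub_add_cancel] at h1
    have := add_mem (hJE h1) (hEpow _ hu)
    convert this using 1
    abel
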